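/- arXiv:2301.11137 — 3 statements merged into one kernel-verified Lean document; each statement's English description precedes it below -/
import Mathlib

section
/- Let q, x, y be complex numbers with |q| < 1. Then (−xq;q²)_∞ (−yq²;q⁴)_∞ = Σ_{n₁,n₂,n₃,n₄ ≥ 0} x^{n₁+n₂+2n₄} y^{n₂+n₃} q^{Q(n₁,n₂,n₃,n₄) + n₁ + 3n₂ + 2n₃ + 4n₄} (1 + x²y q^{6+8(n₁+n₂+n₃+n₄)}) / ((q²;q²)_{n₁}(q²;q²)_{n₂}(q⁴;q⁴)_{n₃}(q⁴;q⁴)_{n₄}), where the quadruple series converges absolutely. -/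
/-- The finite q-Pochhammer symbol `(a; q)_n = ∏_{k=0}^{n-1} (1 - a q^k)`. -/
noncomputable def qPoch (a q : ℂ) (n : ℕ) : ℂ :=
  ∏ k ∈ Finset.range n, (1 - a * q ^ k)

/-- The infinite q-Pochhammer symbol `(a; q)_∞ = ∏_{k=0}^{∞} (1 - a q^k)`. -/
noncomputable def qPochInf (a q : ℂ) : ℂ :=
  ∏' k : ℕ, (1 - a * q ^ k)

/-- The quadratic form
`Q(n₁,n₂,n₃,n₄) = 4C(n₁,2) + 6C(n₂,2) + 4C(n₃,2) + 8C(n₄,2)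
  + 4(n₁n₂ + n₁n₃ + n₁n₄ + n₂n₃ + n₂n₄ + n₃n₄)`. -/
def Qform (n₁ n₂ n₃ n₄ : ℕ) : ℕ :=
  4 * Nat.choose n₁ 2 + 6 * Nat.choose n₂ 2 + 4 * Nat.choose n₃ 2 + 8 * Nat.choose n₄ 2 +
    4 * (n₁ * n₂ + n₁ * n₃ + n₁ * n₄ + n₂ * n₃ + n₂ * n₄ + n₃ * n₄)

/-- The power series `∑ aⁿ zⁿ / (p; p)_n`, formally `1 / (a z; p)_∞`. -/
noncomputable def qExp (a p : ℂ) : PowerSeries ℂ :=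
  PowerSeries.mk fun n => a ^ n / qPoch p p n

/-- The power series `∑ p^C(n,2) aⁿ zⁿ / (p; p)_n`, formally `(-a z; p)_∞`. -/
noncomputable def qExpBig (a p : ℂ) : PowerSeries ℂ :=
  PowerSeries.mk fun n => p ^ n.choose 2 * a ^ n / qPoch p p n

lemma qPoch_self_succ (p : ℂ) (n : ℕ) :
    qPoch p p (n + 1) = qPoch p p n * (1 - p ^ (n + 1)) := by
  simp [qPoch, Finset.prod_range_succ, pow_succ']

lemma one_sub_norm_pow_le_norm_qPoch {p : ℂ} (hp : ‖p‖ < 1) (n : ℕ) :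
    (1 - ‖p‖) ^ n ≤ ‖qPoch p p n‖ := by
  induction n with
  | zero => simp [qPoch]
  | succ n ih =>
    rw [qPoch_self_succ, norm_mul, pow_succ]
    have h1 : 1 - ‖p‖ ≤ ‖1 - p ^ (n + 1)‖ := by
      have h2 := norm_sub_norm_le (1 : ℂ) (p ^ (n + 1))
      have h3 : ‖p‖ ^ (n + 1) ≤ ‖p‖ := pow_le_of_le_one (norm_nonneg _) hp.le (by simp)
      rw [norm_one, norm_pow] at h2
      linarith
    have h4 : 0 ≤ 1 - ‖p‖ := by linarith
    gcongr

lemma qPoch_self_ne_zero {p : ℂ} (hp : ‖p‖ < 1) (n : ℕ) : qPoch p p n ≠ 0 := by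
  rw [← norm_pos_iff]
  exact (pow_pos (by linarith) n).trans_le (one_sub_norm_pow_le_norm_qPoch hp n)

lemma one_sub_pow_succ_ne_zero {p : ℂ} (hp : ‖p‖ < 1) (n : ℕ) : 1 - p ^ (n + 1) ≠ 0 := by
  have h := qPoch_self_ne_zero hp (n + 1)
  rw [qPoch_self_succ] at h
  exact right_ne_zero_of_mul h

lemma coeff_zero_one_add_C_mul_X_mul (a : ℂ) (A : PowerSeries ℂ) :
    PowerSeries.coeff 0 ((1 + PowerSeries.C a * PowerSeries.X) * A) = PowerSeries.coeff 0 A := by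
  rw [add_mul, one_mul, mul_assoc, map_add, PowerSeries.coeff_C_mul,
    PowerSeries.coeff_zero_X_mul, mul_zero, add_zero]

lemma coeff_succ_one_add_C_mul_X_mul (a : ℂ) (A : PowerSeries ℂ) (n : ℕ) :
    PowerSeries.coeff (n + 1) ((1 + PowerSeries.C a * PowerSeries.X) * A) =
      PowerSeries.coeff (n + 1) A + a * PowerSeries.coeff n A := by
  rw [add_mul, one_mul, mul_assoc, map_add, PowerSeries.coeff_C_mul,
    PowerSeries.coeff_succ_X_mul]

lemma choose_succ_two (n : ℕ) : (n + 1).choose 2 = n.choose 2 + n := by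
  rw [Nat.choose_succ_succ' n 1, Nat.choose_one_right, add_comm]

lemma choose_add_two (m n : ℕ) : (m + n).choose 2 = m.choose 2 + n.choose 2 + m * n := by
  induction n with
  | zero => simp
  | succ n ih => rw [← add_assoc, choose_succ_two, choose_succ_two, ih]; ring

lemma qExp_eq_mul {p : ℂ} (hp : ‖p‖ < 1) {a b : ℂ} (h : b = a * p) :
    qExp b p = (1 + PowerSeries.C (-a) * PowerSeries.X) * qExp a p := by
  subst h
  ext n
  cases n with
  | zero => rw [coeff_zero_one_add_C_mul_X_mul]; simp [qExp]
  | succ n =>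
    rw [coeff_succ_one_add_C_mul_X_mul]
    simp only [qExp, PowerSeries.coeff_mk, qPoch_self_succ]
    have h1 := qPoch_self_ne_zero hp n
    have h2 := one_sub_pow_succ_ne_zero hp n
    field_simp
    ring

lemma qExpBig_eq_mul {p : ℂ} (hp : ‖p‖ < 1) {a b c : ℂ} (h : b = a * p) (h' : c = a) :
    qExpBig c p = (1 + PowerSeries.C a * PowerSeries.X) * qExpBig b p := by
  subst h h'
  ext n
  cases n with
  | zero => rw [coeff_zero_one_add_C_mul_X_mul]; simp [qExpBig]
  | succ n =>
    rw [coeff_succ_one_add_C_mul_X_mul]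
    simp only [qExpBig, PowerSeries.coeff_mk, qPoch_self_succ, choose_succ_two]
    have h1 := qPoch_self_ne_zero hp n
    have h2 := one_sub_pow_succ_ne_zero hp n
    field_simp
    ring

lemma rescale_qExp (c a p : ℂ) : PowerSeries.rescale c (qExp a p) = qExp (a * c) p := by
  ext n
  simp only [PowerSeries.coeff_rescale, qExp, PowerSeries.coeff_mk]
  ring

lemma rescale_qExpBig (c a p : ℂ) :
    PowerSeries.rescale c (qExpBig a p) = qExpBig (a * c) p := by
  ext n
  simp only [PowerSeries.coeff_rescale, qExpBig, PowerSeries.coeff_mk]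
  ring

lemma norm_coeff_qExp_le {p a : ℂ} {δ w : ℝ} (hδ : 0 < δ) (hp : ‖p‖ ≤ 1 - δ) (ha : ‖a‖ ≤ w)
    (n : ℕ) : ‖PowerSeries.coeff n (qExp a p)‖ ≤ (w / δ) ^ n := by
  have h := one_sub_norm_pow_le_norm_qPoch (p := p) (by linarith) n
  rw [qExp, PowerSeries.coeff_mk, norm_div, norm_pow, div_pow]
  have : δ ^ n ≤ ‖qPoch p p n‖ := le_trans (by gcongr; linarith) h
  have := (norm_nonneg a).trans ha
  gcongr

lemma norm_coeff_qExpBig_le {p a : ℂ} {δ w : ℝ} (hδ : 0 < δ) (hp : ‖p‖ ≤ 1 - δ) (ha : ‖a‖ ≤ w)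
    (n : ℕ) : ‖PowerSeries.coeff n (qExpBig a p)‖ ≤ (w / δ) ^ n := by
  refine le_trans ?_ (norm_coeff_qExp_le hδ hp ha n)
  rw [qExpBig, qExp, PowerSeries.coeff_mk, PowerSeries.coeff_mk, norm_div, norm_div, norm_mul,
    norm_pow p]
  gcongr
  exact mul_le_of_le_one_left (norm_nonneg _) (pow_le_one₀ (norm_nonneg _) (by linarith))

/-- Power series whose coefficients grow at most exponentially. -/
def ExpBounded (A : PowerSeries ℂ) : Prop :=
  ∃ c r : ℝ, 0 ≤ c ∧ 0 ≤ r ∧ ∀ n, ‖PowerSeries.coeff n A‖ ≤ c * r ^ n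

lemma expBounded_qExp {p : ℂ} (hp : ‖p‖ < 1) (a : ℂ) : ExpBounded (qExp a p) :=
  ⟨1, ‖a‖ / (1 - ‖p‖), zero_le_one, div_nonneg (norm_nonneg _) (by linarith), fun n => by
    simpa using norm_coeff_qExp_le (by linarith : 0 < 1 - ‖p‖) (by linarith) le_rfl n⟩

lemma expBounded_qExpBig {p : ℂ} (hp : ‖p‖ < 1) (a : ℂ) : ExpBounded (qExpBig a p) :=
  ⟨1, ‖a‖ / (1 - ‖p‖), zero_le_one, div_nonneg (norm_nonneg _) (by linarith), fun n => by
    simpa using norm_coeff_qExpBig_le (by linarith : 0 < 1 - ‖p‖) (by linarith) le_rfl n⟩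

lemma ExpBounded.mul {A B : PowerSeries ℂ} (hA : ExpBounded A) (hB : ExpBounded B) :
    ExpBounded (A * B) := by
  obtain ⟨c, r, hc, hr, h⟩ := hA
  obtain ⟨d, s, hd, hs, k⟩ := hB
  refine ⟨c * d, 2 * max r s, by positivity, by positivity, fun n => ?_⟩
  rw [PowerSeries.coeff_mul]
  have hterm : ∀ x ∈ Finset.HasAntidiagonal.antidiagonal n,
      ‖PowerSeries.coeff x.1 A * PowerSeries.coeff x.2 B‖ ≤ c * d * max r s ^ n := by
    intro x hx
    rw [← Finset.HasAntidiagonal.mem_antidiagonal.mp hx, norm_mul, pow_add]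
    calc _ ≤ (c * max r s ^ x.1) * (d * max r s ^ x.2) := by
          gcongr
          · exact (h _).trans (by gcongr; exact le_max_left _ _)
          · exact (k _).trans (by gcongr; exact le_max_right _ _)
      _ = _ := by ring
  refine (norm_sum_le_of_le _ hterm).trans ?_
  rw [Finset.sum_const, Finset.Nat.card_antidiagonal, nsmul_eq_mul, mul_pow]
  have h2 : ((n + 1 : ℕ) : ℝ) ≤ 2 ^ n := by exact_mod_cast Nat.lt_two_pow_self
  calc _ ≤ 2 ^ n * (c * d * max r s ^ n) := by gcongr
    _ = _ := by ring

lemma expBounded_one_add_C_mul_X (a : ℂ) :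
    ExpBounded (1 + PowerSeries.C a * PowerSeries.X) := by
  refine ⟨1, max 1 ‖a‖, zero_le_one, by positivity, fun n => ?_⟩
  rw [← mul_one (1 + _ * _)]
  rcases n with _ | _ | n
  · rw [coeff_zero_one_add_C_mul_X_mul]; simp
  · rw [coeff_succ_one_add_C_mul_X_mul]; simp [PowerSeries.coeff_one]
  · rw [coeff_succ_one_add_C_mul_X_mul]; simp [PowerSeries.coeff_one]

lemma summable_pow_choose_two_mul_pow {p r : ℝ} (hp : 0 ≤ p) (hp1 : p < 1) (hr : 0 ≤ r) :
    Summable fun n : ℕ => p ^ n.choose 2 * r ^ n := by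
  refine summable_of_ratio_norm_eventually_le (r := 1 / 2) (by norm_num) ?_
  have h : Filter.Tendsto (fun n : ℕ => p ^ n * r) Filter.atTop (nhds (0 * r)) :=
    (tendsto_pow_atTop_nhds_zero_of_lt_one hp hp1).mul_const r
  rw [zero_mul] at h
  filter_upwards [h.eventually_le_const (by norm_num : (0 : ℝ) < 1 / 2)] with n hn
  rw [Real.norm_of_nonneg (by positivity), Real.norm_of_nonneg (by positivity), choose_succ_two]
  calc _ = (p ^ n * r) * (p ^ n.choose 2 * r ^ n) := by ring
    _ ≤ _ := by gcongr

/-- The functional sending `zᴺ` to `p^(C(N,2) + jN)`. -/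
noncomputable def gaussMoment (p : ℂ) (j : ℕ) (A : PowerSeries ℂ) : ℂ :=
  ∑' n : ℕ, p ^ n.choose 2 * (p ^ n) ^ j * PowerSeries.coeff n A

lemma ExpBounded.summable_gaussMoment {p : ℂ} (hp : ‖p‖ < 1) (j : ℕ) {A : PowerSeries ℂ}
    (hA : ExpBounded A) :
    Summable fun n : ℕ => p ^ n.choose 2 * (p ^ n) ^ j * PowerSeries.coeff n A := by
  obtain ⟨c, r, hc, hr, h⟩ := hA
  refine Summable.of_norm_bounded
    ((summable_pow_choose_two_mul_pow (norm_nonneg p) hp hr).mul_left c) fun n => ?_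
  rw [norm_mul, norm_mul, norm_pow, norm_pow, norm_pow]
  have h1 : (‖p‖ ^ n) ^ j ≤ 1 :=
    pow_le_one₀ (by positivity) (pow_le_one₀ (norm_nonneg _) hp.le)
  calc _ ≤ ‖p‖ ^ n.choose 2 * 1 * (c * r ^ n) := by gcongr; exact h n
    _ = _ := by ring

lemma ExpBounded.gaussMoment_one_add {p : ℂ} (hp : ‖p‖ < 1) (j : ℕ) (a : ℂ)
    {A : PowerSeries ℂ} (hA : ExpBounded A) :
    gaussMoment p j ((1 + PowerSeries.C a * PowerSeries.X) * A) =
      gaussMoment p j A + a * p ^ j * gaussMoment p (j + 1) A := by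
  have hs := ((expBounded_one_add_C_mul_X a).mul hA).summable_gaussMoment hp j
  have hs0 := hA.summable_gaussMoment hp j
  have hs1 := hA.summable_gaussMoment hp (j + 1)
  simp only [gaussMoment]
  rw [hs.tsum_eq_zero_add, hs0.tsum_eq_zero_add, coeff_zero_one_add_C_mul_X_mul, add_assoc,
    ← tsum_mul_left, ← ((summable_nat_add_iff 1).mpr hs0).tsum_add (hs1.mul_left _)]
  congr 1
  refine tsum_congr fun n => ?_
  rw [coeff_succ_one_add_C_mul_X_mul, choose_succ_two]
  ring

lemma gaussMoment_rescale (p : ℂ) (j : ℕ) (A : PowerSeries ℂ) :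
    gaussMoment p j (PowerSeries.rescale p A) = gaussMoment p (j + 1) A :=
  tsum_congr fun n => by rw [PowerSeries.coeff_rescale]; ring

/-- The contiguous relation for the well-poised functional `gaussMoment p 0 + s gaussMoment p 2`
in the parameter `α`. -/
lemma wellPoised_contiguous {p α β γ : ℂ} (hp : ‖p‖ < 1) {H : PowerSeries ℂ}
    (hH : ExpBounded H)
    (h : (1 + PowerSeries.C (-α) * PowerSeries.X) * ((1 + PowerSeries.C (-β) * PowerSeries.X) *
        ((1 + PowerSeries.C (-γ) * PowerSeries.X) * H)) =
      (1 + PowerSeries.C (α * β * p) * PowerSeries.X) *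
        ((1 + PowerSeries.C (α * γ * p) * PowerSeries.X) *
          ((1 + PowerSeries.C (β * γ) * PowerSeries.X) * PowerSeries.rescale p H)))
    (hR : ExpBounded (PowerSeries.rescale p H)) {A B : PowerSeries ℂ}
    (hA : A = (1 + PowerSeries.C (α * β) * PowerSeries.X) *
      ((1 + PowerSeries.C (α * γ) * PowerSeries.X) * H))
    (hB : B = (1 + PowerSeries.C (-α) * PowerSeries.X) * H) :
    gaussMoment p 0 A + α * β * γ * gaussMoment p 2 A =
      (1 + α) * (gaussMoment p 0 B + α * β * γ * p * gaussMoment p 2 B) := by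
  have key := congrArg (gaussMoment p 0) h
  subst hA hB
  have e := expBounded_one_add_C_mul_X
  simp only [((e _).mul ((e _).mul hH)).gaussMoment_one_add hp,
    ((e _).mul hH).gaussMoment_one_add hp, hH.gaussMoment_one_add hp,
    ((e _).mul ((e _).mul hR)).gaussMoment_one_add hp,
    ((e _).mul hR).gaussMoment_one_add hp, hR.gaussMoment_one_add hp,
    gaussMoment_rescale] at key ⊢
  linear_combination (-α) * key

lemma sum_fiber_mul_coeff {f : ℕ × ℕ × ℕ × ℕ → ℂ} (hf : Summable f) (K : ℕ → ℂ)
    (A B C D : PowerSeries ℂ)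
    (h : ∀ n, f n = K (n.1 + n.2.1 + n.2.2.1 + n.2.2.2) *
      (PowerSeries.coeff n.1 A * (PowerSeries.coeff n.2.1 B *
        (PowerSeries.coeff n.2.2.1 C * PowerSeries.coeff n.2.2.2 D)))) :
    ∑' n, f n = ∑' N, K N * PowerSeries.coeff N (A * (B * (C * D))) := by
  rw [← (hf.hasSum.tsum_fiberwise
    fun n : ℕ × ℕ × ℕ × ℕ => n.1 + n.2.1 + n.2.2.1 + n.2.2.2).tsum_eq]
  refine tsum_congr fun N => ?_
  let box := Finset.range (N + 1)
  have hfib : (fun n : ℕ × ℕ × ℕ × ℕ => n.1 + n.2.1 + n.2.2.1 + n.2.2.2) ⁻¹' {N} =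
      ((box ×ˢ box ×ˢ box ×ˢ box).filter
        fun n => n.1 + n.2.1 + n.2.2.1 + n.2.2.2 = N : Finset (ℕ × ℕ × ℕ × ℕ)) := by
    ext n
    simp only [Set.mem_preimage, Set.mem_singleton_iff, Finset.coe_filter, Finset.mem_product,
      Finset.mem_range, Set.mem_ofPred_eq, box]
    omega
  rw [hfib, Finset.tsum_subtype']
  simp only [PowerSeries.coeff_mul, Finset.mul_sum, Finset.sum_sigma']
  refine Finset.sum_nbij'
    (fun n => ⟨(n.1, n.2.1 + n.2.2.1 + n.2.2.2), ⟨(n.2.1, n.2.2.1 + n.2.2.2),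
      (n.2.2.1, n.2.2.2)⟩⟩)
    (fun t => (t.1.1, t.2.1.1, t.2.2.1, t.2.2.2)) ?_ ?_ ?_ ?_ ?_
  · rintro ⟨a, b, c, d⟩ hn
    simp only [Finset.mem_filter, Finset.mem_sigma,
      Finset.HasAntidiagonal.mem_antidiagonal] at hn ⊢
    exact ⟨by omega, by omega, trivial⟩
  · rintro ⟨⟨a, b⟩, ⟨c, d⟩, ⟨e, g⟩⟩ ht
    simp only [Finset.mem_filter, Finset.mem_sigma, Finset.mem_product, Finset.mem_range, box,
      Finset.HasAntidiagonal.mem_antidiagonal] at ht ⊢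
    omega
  · intro n _
    rfl
  · rintro ⟨⟨a, b⟩, ⟨c, d⟩, ⟨e, g⟩⟩ ht
    simp only [Finset.mem_sigma, Finset.HasAntidiagonal.mem_antidiagonal] at ht
    obtain ⟨h1, h2, h3⟩ := ht
    subst h3 h2 h1
    simp [add_assoc]
  · intro n hn
    rw [h, (Finset.mem_filter.mp hn).2]

lemma summable_pow_choose_two_mul_pow_quadruple {p r : ℝ} (hp : 0 ≤ p) (hp1 : p < 1)
    (hr : 0 ≤ r) :
    Summable fun n : ℕ × ℕ × ℕ × ℕ => p ^ (n.1 + n.2.1 + n.2.2.1 + n.2.2.2).choose 2 *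
      r ^ (n.1 + n.2.1 + n.2.2.1 + n.2.2.2) := by
  have hs := summable_pow_choose_two_mul_pow hp hp1 (by positivity : 0 ≤ 2 * r)
  have hgeo : Summable fun n : ℕ => (1 / 2 : ℝ) ^ n :=
    summable_geometric_of_lt_one (by norm_num) (by norm_num)
  have hnn : (0 : ℕ → ℝ) ≤ fun n : ℕ => (1 / 2 : ℝ) ^ n := fun n => by simp
  have h2 := hgeo.mul_of_nonneg hgeo hnn hnn
  have h3 := hgeo.mul_of_nonneg h2 hnn fun n => by positivity
  have h4 := hgeo.mul_of_nonneg h3 hnn fun n => by positivity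
  refine Summable.of_nonneg_of_le (fun n => by positivity) (fun n => ?_)
    (h4.mul_left (∑' N : ℕ, p ^ N.choose 2 * (2 * r) ^ N))
  have hle := hs.le_tsum (n.1 + n.2.1 + n.2.2.1 + n.2.2.2) fun _ _ => by positivity
  calc _ = p ^ (n.1 + n.2.1 + n.2.2.1 + n.2.2.2).choose 2 *
        (2 * r) ^ (n.1 + n.2.1 + n.2.2.1 + n.2.2.2) *
        (1 / 2) ^ (n.1 + n.2.1 + n.2.2.1 + n.2.2.2) := by
        rw [mul_assoc, ← mul_pow]
        ring_nf
    _ ≤ (∑' N : ℕ, p ^ N.choose 2 * (2 * r) ^ N) *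
        (1 / 2) ^ (n.1 + n.2.1 + n.2.2.1 + n.2.2.2) := by gcongr
    _ = _ := by simp only [pow_add]; ring

/-- The summand of the quadruple series, in terms of power series coefficients. -/
noncomputable def quadTerm (q x y : ℂ) (n : ℕ × ℕ × ℕ × ℕ) : ℂ :=
  (q ^ 4) ^ (n.1 + n.2.1 + n.2.2.1 + n.2.2.2).choose 2 *
    (1 + x ^ 2 * y * q ^ 6 * ((q ^ 4) ^ (n.1 + n.2.1 + n.2.2.1 + n.2.2.2)) ^ 2) *
    (PowerSeries.coeff n.1 (qExp (x * q) (q ^ 2)) *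
      (PowerSeries.coeff n.2.1 (qExpBig (x * y * q ^ 3) (q ^ 2)) *
        (PowerSeries.coeff n.2.2.1 (qExp (y * q ^ 2) (q ^ 4)) *
          PowerSeries.coeff n.2.2.2 (qExpBig (x ^ 2 * q ^ 4) (q ^ 4)))))

lemma Qform_eq (a b c d : ℕ) :
    Qform a b c d = 4 * (a + b + c + d).choose 2 + 2 * b.choose 2 + 4 * d.choose 2 := by
  simp only [Qform, choose_add_two]
  ring

lemma quadTerm_eq (q x y : ℂ) (n : ℕ × ℕ × ℕ × ℕ) :
    x ^ (n.1 + n.2.1 + 2 * n.2.2.2) * y ^ (n.2.1 + n.2.2.1) *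
      q ^ (Qform n.1 n.2.1 n.2.2.1 n.2.2.2 + n.1 + 3 * n.2.1 + 2 * n.2.2.1 + 4 * n.2.2.2) *
      (1 + x ^ 2 * y * q ^ (6 + 8 * (n.1 + n.2.1 + n.2.2.1 + n.2.2.2))) /
      (qPoch (q ^ 2) (q ^ 2) n.1 * qPoch (q ^ 2) (q ^ 2) n.2.1 *
        qPoch (q ^ 4) (q ^ 4) n.2.2.1 * qPoch (q ^ 4) (q ^ 4) n.2.2.2) = quadTerm q x y n := by
  obtain ⟨a, b, c, d⟩ := n
  simp only [quadTerm, Qform_eq, qExp, qExpBig, PowerSeries.coeff_mk, div_eq_mul_inv, mul_inv]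
  rw [pow_add q 6, pow_mul q 8]
  generalize (a + b + c + d).choose 2 = m
  generalize b.choose 2 = k
  generalize d.choose 2 = l
  generalize a + b + c + d = N
  have h8 : ((q ^ 4) ^ N) ^ 2 = (q ^ 8) ^ N := by ring
  rw [h8, ← mul_assoc (x ^ 2 * y) (q ^ 6)]
  generalize 1 + x ^ 2 * y * q ^ 6 * (q ^ 8) ^ N = w
  ring

lemma norm_pow_le_self {q : ℂ} (hq : ‖q‖ < 1) {n : ℕ} (hn : n ≠ 0) : ‖q ^ n‖ ≤ ‖q‖ := by
  rw [norm_pow]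
  exact pow_le_of_le_one (norm_nonneg _) hq.le hn

lemma norm_quadTerm_le {q x y : ℂ} {w : ℝ} (hq : ‖q‖ < 1) (hw : 1 ≤ w) (hx : ‖x‖ ≤ w)
    (hy : ‖y‖ ≤ w) (n : ℕ × ℕ × ℕ × ℕ) :
    ‖quadTerm q x y n‖ ≤ (1 + w ^ 3) *
      (‖q ^ 4‖ ^ (n.1 + n.2.1 + n.2.2.1 + n.2.2.2).choose 2 *
        (w ^ 2 / (1 - ‖q‖)) ^ (n.1 + n.2.1 + n.2.2.1 + n.2.2.2)) := by
  have hδ : 0 < 1 - ‖q‖ := by linarith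
  have hpow : ∀ k, ‖q ^ k‖ ≤ 1 := fun k => by
    rw [norm_pow]; exact pow_le_one₀ (norm_nonneg _) hq.le
  have hp2 : ‖q ^ 2‖ ≤ 1 - (1 - ‖q‖) := by linarith [norm_pow_le_self hq two_ne_zero]
  have hp4 : ‖q ^ 4‖ ≤ 1 - (1 - ‖q‖) := by linarith [norm_pow_le_self hq four_ne_zero]
  have hw2 : w ≤ w ^ 2 := le_self_pow₀ hw two_ne_zero
  have key : ∀ (z : ℂ) (k : ℕ), ‖z‖ ≤ w ^ 2 → ‖z * q ^ k‖ ≤ w ^ 2 := fun z k hz => by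
    rw [norm_mul]
    exact (mul_le_of_le_one_right (norm_nonneg _) (hpow k)).trans hz
  have ha := norm_coeff_qExp_le hδ hp2 (pow_one q ▸ key x 1 (hx.trans hw2)) n.1
  have hb := norm_coeff_qExpBig_le hδ hp2
    (key (x * y) 3 (by rw [norm_mul, sq]; gcongr)) n.2.1
  have hc := norm_coeff_qExp_le hδ hp4 (key y 2 (hy.trans hw2)) n.2.2.1
  have hd := norm_coeff_qExpBig_le hδ hp4
    (key (x ^ 2) 4 (by rw [norm_pow]; gcongr)) n.2.2.2
  have hs : ‖1 + x ^ 2 * y * q ^ 6 * ((q ^ 4) ^ (n.1 + n.2.1 + n.2.2.1 + n.2.2.2)) ^ 2‖ ≤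
      1 + w ^ 3 := by
    refine (norm_add_le _ _).trans ?_
    rw [norm_one, mul_assoc, ← pow_mul, ← pow_mul, ← pow_add, norm_mul, norm_mul, norm_pow x]
    gcongr
    calc _ ≤ w ^ 2 * w * 1 := by gcongr; exact hpow _
      _ = _ := by ring
  rw [quadTerm]
  simp only [norm_mul]
  calc _ ≤ ‖(q ^ 4) ^ (n.1 + n.2.1 + n.2.2.1 + n.2.2.2).choose 2‖ * (1 + w ^ 3) *
        ((w ^ 2 / (1 - ‖q‖)) ^ n.1 * ((w ^ 2 / (1 - ‖q‖)) ^ n.2.1 *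
          ((w ^ 2 / (1 - ‖q‖)) ^ n.2.2.1 * (w ^ 2 / (1 - ‖q‖)) ^ n.2.2.2))) := by gcongr
    _ = _ := by rw [norm_pow]; simp only [pow_add]; ring

lemma norm_pow_four_lt_one {q : ℂ} (hq : ‖q‖ < 1) : ‖q ^ 4‖ < 1 :=
  (norm_pow_le_self hq four_ne_zero).trans_lt hq

lemma summable_quadTerm_bound {q : ℂ} (hq : ‖q‖ < 1) (w : ℝ) :
    Summable fun n : ℕ × ℕ × ℕ × ℕ => (1 + w ^ 3) *
      (‖q ^ 4‖ ^ (n.1 + n.2.1 + n.2.2.1 + n.2.2.2).choose 2 *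
        (w ^ 2 / (1 - ‖q‖)) ^ (n.1 + n.2.1 + n.2.2.1 + n.2.2.2)) :=
  (summable_pow_choose_two_mul_pow_quadruple (norm_nonneg _) (norm_pow_four_lt_one hq)
    (div_nonneg (sq_nonneg _) (by linarith))).mul_left _

lemma summable_quadTerm {q : ℂ} (hq : ‖q‖ < 1) (x y : ℂ) : Summable (quadTerm q x y) :=
  Summable.of_norm_bounded (summable_quadTerm_bound hq (max 1 (max ‖x‖ ‖y‖)))
    (norm_quadTerm_le hq (le_max_left _ _) ((le_max_left _ _).trans (le_max_right _ _))
      ((le_max_right _ _).trans (le_max_right _ _)))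

/-- The generating function of the quadruple series by `n₁ + n₂ + n₃ + n₄`. -/
noncomputable def quadSeries (q x y : ℂ) : PowerSeries ℂ :=
  qExp (x * q) (q ^ 2) * (qExpBig (x * y * q ^ 3) (q ^ 2) *
    (qExp (y * q ^ 2) (q ^ 4) * qExpBig (x ^ 2 * q ^ 4) (q ^ 4)))

lemma norm_sq_lt_one {q : ℂ} (hq : ‖q‖ < 1) : ‖q ^ 2‖ < 1 :=
  (norm_pow_le_self hq two_ne_zero).trans_lt hq

lemma expBounded_qExp_mul {q : ℂ} (hq : ‖q‖ < 1) (a b c d : ℂ) :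
    ExpBounded (qExp a (q ^ 2) * (qExpBig b (q ^ 2) *
      (qExp c (q ^ 4) * qExpBig d (q ^ 4)))) :=
  (expBounded_qExp (norm_sq_lt_one hq) _).mul <|
    (expBounded_qExpBig (norm_sq_lt_one hq) _).mul <|
    (expBounded_qExp (norm_pow_four_lt_one hq) _).mul <|
    expBounded_qExpBig (norm_pow_four_lt_one hq) _

lemma tsum_quadTerm {q : ℂ} (hq : ‖q‖ < 1) (x y : ℂ) :
    ∑' n, quadTerm q x y n = gaussMoment (q ^ 4) 0 (quadSeries q x y) +
      x ^ 2 * y * q ^ 6 * gaussMoment (q ^ 4) 2 (quadSeries q x y) := by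
  have hb : ExpBounded (quadSeries q x y) := expBounded_qExp_mul hq _ _ _ _
  rw [sum_fiber_mul_coeff (summable_quadTerm hq x y)
    (fun N => (q ^ 4) ^ N.choose 2 * (1 + x ^ 2 * y * q ^ 6 * ((q ^ 4) ^ N) ^ 2))
    _ _ _ _ fun n => rfl, gaussMoment, gaussMoment, ← tsum_mul_left,
    ← (hb.summable_gaussMoment (norm_pow_four_lt_one hq) 0).tsum_add
      ((hb.summable_gaussMoment (norm_pow_four_lt_one hq) 2).mul_left _)]
  refine tsum_congr fun N => ?_
  rw [quadSeries]
  ring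

lemma tsum_quadTerm_shift_left {q : ℂ} (hq : ‖q‖ < 1) (x y : ℂ) :
    ∑' n, quadTerm q x y n = (1 + x * q) * ∑' n, quadTerm q (x * q ^ 2) y n := by
  have h2 := norm_sq_lt_one hq
  have h4 := norm_pow_four_lt_one hq
  have key := wellPoised_contiguous (p := q ^ 4) (α := x * q) (β := x * q * q ^ 2)
    (γ := y * q ^ 2) h4
    (H := qExp (x * q) (q ^ 2) * (qExpBig (x * q * q ^ 2 * (y * q ^ 2)) (q ^ 2) *
      (qExp (y * q ^ 2) (q ^ 4) * qExpBig (x * q * (x * q * q ^ 2) * q ^ 4) (q ^ 4))))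
    (A := quadSeries q x y) (B := quadSeries q (x * q ^ 2) y)
    (expBounded_qExp_mul hq _ _ _ _) ?_ ?_ ?_ ?_
  · rw [tsum_quadTerm hq, tsum_quadTerm hq]
    linear_combination key
  · simp only [map_mul (PowerSeries.rescale (q ^ 4)), rescale_qExp, rescale_qExpBig]
    rw [qExp_eq_mul h2 (show x * q * q ^ 4 = x * q * q ^ 2 * q ^ 2 by ring),
      qExp_eq_mul h2 (rfl : x * q * q ^ 2 = _),
      qExp_eq_mul h4 (rfl : y * q ^ 2 * q ^ 4 = _),
      qExpBig_eq_mul h4 (rfl : x * q * (x * q * q ^ 2) * q ^ 4 * q ^ 4 = _) rfl,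
      qExpBig_eq_mul h2 (a := x * q * q ^ 2 * (y * q ^ 2)) rfl rfl,
      qExpBig_eq_mul h2 (a := x * q * (y * q ^ 2) * q ^ 4)
        (show x * q * q ^ 2 * (y * q ^ 2) * q ^ 4 = _ by ring) (by ring)]
    ring
  · simp only [map_mul (PowerSeries.rescale (q ^ 4)), rescale_qExp, rescale_qExpBig]
    exact expBounded_qExp_mul hq _ _ _ _
  · rw [quadSeries, qExpBig_eq_mul h2 (a := x * q * (y * q ^ 2))
      (show x * q * q ^ 2 * (y * q ^ 2) = _ by ring) (by ring),
      qExpBig_eq_mul h4 (a := x * q * (x * q * q ^ 2)) rfl (by ring)]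
    ring
  · rw [quadSeries, qExp_eq_mul h2 (show x * q ^ 2 * q = x * q * q ^ 2 by ring),
      show x * q ^ 2 * y * q ^ 3 = x * q * q ^ 2 * (y * q ^ 2) by ring,
      show (x * q ^ 2) ^ 2 * q ^ 4 = x * q * (x * q * q ^ 2) * q ^ 4 by ring]
    ring

lemma tsum_quadTerm_shift_right {q : ℂ} (hq : ‖q‖ < 1) (x y : ℂ) :
    ∑' n, quadTerm q x y n = (1 + y * q ^ 2) * ∑' n, quadTerm q x (y * q ^ 4) n := by
  have h2 := norm_sq_lt_one hq
  have h4 := norm_pow_four_lt_one hq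
  have key := wellPoised_contiguous (p := q ^ 4) (α := y * q ^ 2) (β := x * q)
    (γ := x * q * q ^ 2) h4
    (H := qExp (x * q) (q ^ 2) * (qExpBig (y * q ^ 2 * (x * q) * q ^ 4) (q ^ 2) *
      (qExp (y * q ^ 2) (q ^ 4) * qExpBig (x * q * (x * q * q ^ 2)) (q ^ 4))))
    (A := quadSeries q x y) (B := quadSeries q x (y * q ^ 4))
    (expBounded_qExp_mul hq _ _ _ _) ?_ ?_ ?_ ?_
  · rw [tsum_quadTerm hq, tsum_quadTerm hq]
    linear_combination key
  · simp only [map_mul (PowerSeries.rescale (q ^ 4)), rescale_qExp, rescale_qExpBig]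
    rw [qExp_eq_mul h2 (show x * q * q ^ 4 = x * q * q ^ 2 * q ^ 2 by ring),
      qExp_eq_mul h2 (rfl : x * q * q ^ 2 = _),
      qExp_eq_mul h4 (rfl : y * q ^ 2 * q ^ 4 = _),
      qExpBig_eq_mul h4 (rfl : x * q * (x * q * q ^ 2) * q ^ 4 = _) rfl,
      qExpBig_eq_mul h2 (a := y * q ^ 2 * (x * q) * q ^ 4) rfl rfl,
      qExpBig_eq_mul h2 (a := y * q ^ 2 * (x * q * q ^ 2) * q ^ 4)
        (show y * q ^ 2 * (x * q) * q ^ 4 * q ^ 4 = _ by ring) (by ring)]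
    ring
  · simp only [map_mul (PowerSeries.rescale (q ^ 4)), rescale_qExp, rescale_qExpBig]
    exact expBounded_qExp_mul hq _ _ _ _
  · rw [quadSeries, qExpBig_eq_mul h2 (a := y * q ^ 2 * (x * q)) rfl (by ring),
      qExpBig_eq_mul h2 (a := y * q ^ 2 * (x * q * q ^ 2))
      (show y * q ^ 2 * (x * q) * q ^ 4 = _ by ring) (by ring),
      show x ^ 2 * q ^ 4 = x * q * (x * q * q ^ 2) by ring]
    ring
  · rw [quadSeries, qExp_eq_mul h4 (show y * q ^ 4 * q ^ 2 = y * q ^ 2 * q ^ 4 by ring),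
      show x * (y * q ^ 4) * q ^ 3 = y * q ^ 2 * (x * q) * q ^ 4 by ring,
      show x ^ 2 * q ^ 4 = x * q * (x * q * q ^ 2) by ring]
    ring

lemma tsum_quadTerm_eq_prod {q : ℂ} (hq : ‖q‖ < 1) (x y : ℂ) (m : ℕ) :
    ∑' n, quadTerm q x y n =
      ((∏ k ∈ Finset.range m, (1 - -(x * q) * (q ^ 2) ^ k)) *
        ∏ k ∈ Finset.range m, (1 - -(y * q ^ 2) * (q ^ 4) ^ k)) *
          ∑' n, quadTerm q (x * (q ^ 2) ^ m) (y * (q ^ 4) ^ m) n := by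
  induction m with
  | zero => simp
  | succ m ih =>
    rw [ih, Finset.prod_range_succ, Finset.prod_range_succ, tsum_quadTerm_shift_left hq,
      tsum_quadTerm_shift_right hq, pow_succ (q ^ 2), pow_succ (q ^ 4),
      ← mul_assoc x ((q ^ 2) ^ m), ← mul_assoc y ((q ^ 4) ^ m)]
    ring

lemma quadTerm_zero_zero (q : ℂ) {n : ℕ × ℕ × ℕ × ℕ} (hn : n ≠ 0) : quadTerm q 0 0 n = 0 := by
  obtain ⟨a, b, c, d⟩ := n
  rw [← quadTerm_eq]
  have h : a + b + 2 * d ≠ 0 ∨ b + c ≠ 0 := by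
    by_contra! h0
    apply hn
    simp only [Prod.mk_eq_zero]
    omega
  rcases h with h | h <;> simp [zero_pow h]

lemma tendsto_tsum_quadTerm {q : ℂ} (hq : ‖q‖ < 1) (x y : ℂ) :
    Filter.Tendsto (fun m : ℕ => ∑' n, quadTerm q (x * (q ^ 2) ^ m) (y * (q ^ 4) ^ m) n)
      Filter.atTop (nhds 1) := by
  have h1 : ∑' n, quadTerm q 0 0 n = 1 := by
    rw [tsum_eq_single 0 fun n hn => quadTerm_zero_zero q hn, ← quadTerm_eq]
    simp [Qform, qPoch]
  rw [← h1]
  refine tendsto_tsum_of_dominated_convergence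
    (summable_quadTerm_bound hq (max 1 (max ‖x‖ ‖y‖))) (fun n => ?_)
    (Filter.Eventually.of_forall fun m n => ?_)
  · have hx : Filter.Tendsto (fun m : ℕ => x * (q ^ 2) ^ m) Filter.atTop (nhds 0) := by
      simpa using (tendsto_pow_atTop_nhds_zero_of_norm_lt_one (norm_sq_lt_one hq)).const_mul x
    have hy : Filter.Tendsto (fun m : ℕ => y * (q ^ 4) ^ m) Filter.atTop (nhds 0) := by
      simpa using
        (tendsto_pow_atTop_nhds_zero_of_norm_lt_one (norm_pow_four_lt_one hq)).const_mul y
    have hc : Continuous fun z : ℂ × ℂ => quadTerm q z.1 z.2 n := by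
      simp only [quadTerm, qExp, qExpBig, PowerSeries.coeff_mk]
      fun_prop
    have hlim := (hc.tendsto (0, 0)).comp (hx.prodMk_nhds hy)
    simpa only [Function.comp_def] using hlim
  · have hle : ∀ z p : ℂ, ‖p‖ < 1 → ‖z * p ^ m‖ ≤ ‖z‖ := fun z p hp => by
      rw [norm_mul, norm_pow]
      exact mul_le_of_le_one_right (norm_nonneg _) (pow_le_one₀ (norm_nonneg _) hp.le)
    exact norm_quadTerm_le hq (le_max_left _ _)
      ((hle x _ (norm_sq_lt_one hq)).trans ((le_max_left _ _).trans (le_max_right _ _)))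
      ((hle y _ (norm_pow_four_lt_one hq)).trans ((le_max_right _ _).trans (le_max_right _ _))) n

lemma tendsto_qPochInf {p : ℂ} (hp : ‖p‖ < 1) (a : ℂ) :
    Filter.Tendsto (fun m : ℕ => ∏ k ∈ Finset.range m, (1 - a * p ^ k)) Filter.atTop
      (nhds (qPochInf a p)) := by
  refine Multipliable.tendsto_prod_tprod_nat ?_
  simp only [sub_eq_add_neg]
  refine Complex.multipliable_one_add_of_summable ?_
  exact ((summable_geometric_of_norm_lt_one hp).mul_left a).neg

/-- **Theorem 1.2** (trivariate Rogers–Ramanujan type identity):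
`(−xq;q²)_∞ (−yq²;q⁴)_∞` equals the quadruple Andrews–Gordon type series. -/
theorem quadruple_identity (q x y : ℂ) (hq : ‖q‖ < 1) :
    Summable (fun n : ℕ × ℕ × ℕ × ℕ =>
      x ^ (n.1 + n.2.1 + 2 * n.2.2.2) * y ^ (n.2.1 + n.2.2.1) *
        q ^ (Qform n.1 n.2.1 n.2.2.1 n.2.2.2 + n.1 + 3 * n.2.1 + 2 * n.2.2.1 + 4 * n.2.2.2) *
        (1 + x ^ 2 * y * q ^ (6 + 8 * (n.1 + n.2.1 + n.2.2.1 + n.2.2.2))) /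
        (qPoch (q ^ 2) (q ^ 2) n.1 * qPoch (q ^ 2) (q ^ 2) n.2.1 *
          qPoch (q ^ 4) (q ^ 4) n.2.2.1 * qPoch (q ^ 4) (q ^ 4) n.2.2.2)) ∧
    qPochInf (-(x * q)) (q ^ 2) * qPochInf (-(y * q ^ 2)) (q ^ 4) =
      ∑' n : ℕ × ℕ × ℕ × ℕ,
        x ^ (n.1 + n.2.1 + 2 * n.2.2.2) * y ^ (n.2.1 + n.2.2.1) *
          q ^ (Qform n.1 n.2.1 n.2.2.1 n.2.2.2 + n.1 + 3 * n.2.1 + 2 * n.2.2.1 + 4 * n.2.2.2) *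
          (1 + x ^ 2 * y * q ^ (6 + 8 * (n.1 + n.2.1 + n.2.2.1 + n.2.2.2))) /
          (qPoch (q ^ 2) (q ^ 2) n.1 * qPoch (q ^ 2) (q ^ 2) n.2.1 *
            qPoch (q ^ 4) (q ^ 4) n.2.2.1 * qPoch (q ^ 4) (q ^ 4) n.2.2.2) := by
  simp only [quadTerm_eq]
  refine ⟨summable_quadTerm hq x y, ?_⟩
  have h := ((tendsto_qPochInf (norm_sq_lt_one hq) (-(x * q))).mul
    (tendsto_qPochInf (norm_pow_four_lt_one hq) (-(y * q ^ 2)))).mul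
      (tendsto_tsum_quadTerm hq x y)
  simp only [← tsum_quadTerm_eq_prod hq, mul_one] at h
  exact tendsto_nhds_unique h tendsto_const_nhds
end

section
/- For nonnegative integers n, m, ℓ, let A(n,m,ℓ) be the number of overpartitions λ = (P,O) in 𝒜_{1̄}^⋁ with |λ| = n, ♯_{1,2}(λ) + 2♯_{0,4}(λ) = m, and ♯_{2,4}(λ) + 𝖮(λ) = ℓ. Let B(n,m,ℓ) be the number of finite sets S of positive integers with no element divisible by 4, exactly m odd elements, exactly ℓ even elements, and Σ_{s∈S} s = n. Then A(n,m,ℓ) = B(n,m,ℓ). -/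
/-- Membership in the set `𝒜_{1̄}^⋁`: an overpartition is a pair `(P, O)` with `P` a finite
set of positive integers (the parts) and `O ⊆ {p ∈ P : p odd, p > 1}` (the overlined parts),
such that any two parts `a > b` differ by at least 4 — strictly more than 4 if `a` is
overlined or divisible by 4 — except that `5̄` and `1` may appear simultaneously. -/
def MemAVee (P O : Finset ℕ) : Prop :=
  (∀ p ∈ P, 0 < p) ∧ O ⊆ P ∧ (∀ p ∈ O, Odd p ∧ 1 < p) ∧
    ∀ a ∈ P, ∀ b ∈ P, b < a → ¬(a = 5 ∧ a ∈ O ∧ b = 1) →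
      4 ≤ a - b ∧ ((a ∈ O ∨ 4 ∣ a) → 5 ≤ a - b)

/-- `♯_{a,M}(λ)`: the number of parts of `λ` congruent to `a` modulo `M`. -/
def countMod (a M : ℕ) (P : Finset ℕ) : ℕ := (P.filter fun p => p % M = a).card

/-- `A(n,m,ℓ)`: number of overpartitions `λ = (P,O) ∈ 𝒜_{1̄}^⋁` with `|λ| = n`,
`♯_{1,2}(λ) + 2♯_{0,4}(λ) = m` and `♯_{2,4}(λ) + 𝖮(λ) = ℓ`. -/
noncomputable def Acount (n m ℓ : ℕ) : ℕ :=
  Set.ncard {lam : Finset ℕ × Finset ℕ | MemAVee lam.1 lam.2 ∧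
    lam.1.sum id = n ∧ countMod 1 2 lam.1 + 2 * countMod 0 4 lam.1 = m ∧
    countMod 2 4 lam.1 + lam.2.card = ℓ}

/-- `B(n,m,ℓ)`: number of 4-regular partitions of `n` into distinct parts with `m` odd
parts and `ℓ` even parts. -/
noncomputable def Bcount (n m ℓ : ℕ) : ℕ :=
  Set.ncard {S : Finset ℕ | (∀ s ∈ S, 0 < s ∧ ¬(4 ∣ s)) ∧ S.sum id = n ∧
    (S.filter fun s => Odd s).card = m ∧ (S.filter fun s => Even s).card = ℓ}

/-- Two auxiliary sequences, given by a coupled recurrence in the elementary symmetric functions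
`e₁, e₂, e₃` of three colour weights. See `partGF_colour_eq` for their relation to the generating
functions of the members of `𝒜_{1̄}^⋁` with bounded parts. -/
def colourSeq {R : Type*} [CommRing R] (e₁ e₂ e₃ Q : R) : ℕ → R × R
  | 0 => (2, e₂ - e₃)
  | 1 => (1 + e₁, (1 + e₁) * e₂ - 2 * e₃)
  | n + 2 =>
    let F := (1 + e₁ * Q ^ (n + 1)) * (colourSeq e₁ e₂ e₃ Q (n + 1)).1 +
      e₃ * Q ^ n * (colourSeq e₁ e₂ e₃ Q n).1 +
      (1 - Q ^ (n + 1)) * Q ^ n * (colourSeq e₁ e₂ e₃ Q n).2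
    (F, (e₂ - e₃) * F + e₃ * (e₁ - 1) * Q ^ (n + 1) * (colourSeq e₁ e₂ e₃ Q (n + 1)).1 -
      e₃ * Q ^ (2 * n + 1) * (colourSeq e₁ e₂ e₃ Q n).2)

/-- The first sequence of `colourSeq`, for colour weights `a, b, c`. -/
def colourF {R : Type*} [CommRing R] (a b c Q : R) (n : ℕ) : R :=
  (colourSeq (a + b + c) (a * b + a * c + b * c) (a * b * c) Q n).1

/-- The second sequence of `colourSeq`, for colour weights `a, b, c`. -/
def colourZ {R : Type*} [CommRing R] (a b c Q : R) (n : ℕ) : R :=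
  (colourSeq (a + b + c) (a * b + a * c + b * c) (a * b * c) Q n).2

section ColourSeq

variable {R : Type*} [CommRing R] (a b c Q : R)

theorem colourF_zero : colourF a b c Q 0 = 2 := rfl

theorem colourZ_zero : colourZ a b c Q 0 = a * b + a * c + b * c - a * b * c := rfl

theorem colourF_one : colourF a b c Q 1 = 1 + (a + b + c) := rfl

theorem colourZ_one : colourZ a b c Q 1 =
    (1 + (a + b + c)) * (a * b + a * c + b * c) - 2 * (a * b * c) := rfl

theorem colourF_add_two (n : ℕ) : colourF a b c Q (n + 2) =
    (1 + (a + b + c) * Q ^ (n + 1)) * colourF a b c Q (n + 1) +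
      a * b * c * Q ^ n * colourF a b c Q n +
      (1 - Q ^ (n + 1)) * Q ^ n * colourZ a b c Q n := rfl

theorem colourZ_add_two (n : ℕ) : colourZ a b c Q (n + 2) =
    (a * b + a * c + b * c - a * b * c) * colourF a b c Q (n + 2) +
      a * b * c * (a + b + c - 1) * Q ^ (n + 1) * colourF a b c Q (n + 1) -
      a * b * c * Q ^ (2 * n + 1) * colourZ a b c Q n := rfl

theorem colourF_rotate : colourF a b c Q = colourF c a b Q := by
  funext n
  unfold colourF
  congr 2 <;> ring

/-- The contiguous relations that express `colourF` and `colourZ` at `a` through their values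
at `a * Q`. -/
theorem colour_contiguous (n : ℕ) :
    (b + a * Q * c) * (c + a * Q * b) *
        (colourF a b c Q (n + 2) - colourF (a * Q) b c Q (n + 2)) =
      a * (1 - Q ^ (n + 2)) *
        (b * c * (a * Q - 1) * (a * Q + b + c - 1) * colourF (a * Q) b c Q (n + 1) +
          (b + c) * colourZ (a * Q) b c Q (n + 1) -
          b * c * (a * Q - 1) * Q ^ n * colourZ (a * Q) b c Q n) ∧
    (b + a * Q * c) * (c + a * Q * b) * colourZ a b c Q (n + 2) =
      (b^2*c^2 + a*b*c^2 + a*b*c^3*Q + a*b^2*c + a*b^3*c*Q + a^2*c^3*Q + a^2*b*c^2*Q +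
          a^2*b^2*c*Q + a^2*b^2*c^2*Q^2 + a^2*b^3*Q + a^3*b*c^2*Q^2 + a^3*b^2*c*Q^2) *
          colourF (a * Q) b c Q (n + 2) +
        (a^2*b*c*(b + c)*(1 - a*Q)*(1 - b)*(1 - c) +
          Q ^ n * Q^2 * (-a*b^2*c^2 + a*b^2*c^3 + a*b^3*c^2 + 2*a^2*b^2*c^2*Q - a^2*b^2*c^3*Q -
            a^2*b^3*c^2*Q + a^3*b*c^2*Q - a^3*b*c^3*Q + a^3*b^2*c*Q - 2*a^3*b^2*c^2*Q -
            a^3*b^2*c^2*Q^2 - a^3*b^3*c*Q - a^4*b*c^2*Q^2 - a^4*b^2*c*Q^2)) *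
          colourF (a * Q) b c Q (n + 1) +
        (a^2*c^2 + a^2*b*c - a^2*b*c^2 + a^2*b^2 - a^2*b^2*c + a^3*b*c*Q -
          Q ^ n * (a*b*c*Q + Q^2*(a*b*c^2 + a*b^2*c + a^2*c^2 + a^2*b*c + a^2*b^2))) *
          colourZ (a * Q) b c Q (n + 1) +
        (Q ^ n * (a^2*b*c*(b + c - b*c + a*b*c*Q)) +
          (Q ^ n)^2 * Q^2 * (a*b*c*(a*Q*(a*b + a*c + b*c) - b*c))) *
          colourZ (a * Q) b c Q n := by
  induction n using Nat.twoStepInduction with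
  | zero =>
    simp only [colourF_add_two, colourZ_add_two, zero_add, colourF_one, colourZ_one, colourF_zero,
      colourZ_zero]
    constructor <;> ring
  | one =>
    simp only [colourF_add_two, colourZ_add_two, Nat.reduceAdd, zero_add, colourF_one, colourZ_one,
      colourF_zero, colourZ_zero]
    constructor <;> ring
  | more n ih₀ ih₁ =>
    obtain ⟨hF₀, hZ₀⟩ := ih₀
    obtain ⟨hF₁, -⟩ := ih₁
    have hF : (b + a * Q * c) * (c + a * Q * b) *
        (colourF a b c Q (n + 4) - colourF (a * Q) b c Q (n + 4)) =
      a * (1 - Q ^ (n + 4)) *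
        (b * c * (a * Q - 1) * (a * Q + b + c - 1) * colourF (a * Q) b c Q (n + 3) +
          (b + c) * colourZ (a * Q) b c Q (n + 3) -
          b * c * (a * Q - 1) * Q ^ (n + 2) * colourZ (a * Q) b c Q (n + 2)) := by
      have E := colourF_add_two a b c Q (n + 2)
      have E4 := colourF_add_two (a * Q) b c Q (n + 2)
      have E3 := colourF_add_two (a * Q) b c Q (n + 1)
      have Z3 := colourZ_add_two (a * Q) b c Q (n + 1)
      have Z2 := colourZ_add_two (a * Q) b c Q n
      simp only [add_assoc, Nat.reduceAdd] at E E4 E3 Z3 Z2 hF₁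
      simp only [E4, Z3, E3, Z2] at hF₁ ⊢
      linear_combination (b + a * Q * c) * (c + a * Q * b) * E +
        (1 + (a + (b + c)) * Q ^ (n + 3)) * hF₁ + a * b * c * Q ^ (n + 2) * hF₀ +
        (1 - Q ^ (n + 3)) * Q ^ (n + 2) * hZ₀
    refine ⟨hF, ?_⟩
    have E := colourZ_add_two a b c Q (n + 2)
    have E4 := colourF_add_two (a * Q) b c Q (n + 2)
    have E3 := colourF_add_two (a * Q) b c Q (n + 1)
    have Z3 := colourZ_add_two (a * Q) b c Q (n + 1)
    have Z2 := colourZ_add_two (a * Q) b c Q n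
    simp only [add_assoc, Nat.reduceAdd] at E E4 E3 Z3 Z2 hF₁ hF ⊢
    simp only [E4, Z3, E3, Z2] at hF₁ hF ⊢
    linear_combination (b + a * Q * c) * (c + a * Q * b) * E +
      (a * b + (a * c + b * c) - a * b * c) * hF +
      a * b * c * (a + (b + (c - 1))) * Q ^ (n + 3) * hF₁ -
      a * b * c * Q ^ (2 * (n + 2) + 1) * hZ₀

end ColourSeq
theorem memAVee_mono {P O P' O' : Finset ℕ} (h : MemAVee P O) (hP : P' ⊆ P) (hO : O' ⊆ P')
    (hOO : ∀ p ∈ P', p ∈ O' ↔ p ∈ O) : MemAVee P' O' := by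
  obtain ⟨h1, h2, h3, h4⟩ := h
  refine ⟨fun p hp => h1 p (hP hp), hO, fun p hp => h3 p ((hOO p (hO hp)).1 hp), ?_⟩
  intro a ha b hb hab he
  rw [hOO a ha] at he ⊢
  exact h4 a (hP ha) b (hP hb) hab he

/-- Adding a new largest part `M` that is not overlined. -/
theorem memAVee_insert_left_iff {P O : Finset ℕ} {M : ℕ} (hP : ∀ p ∈ P, p < M) (hO : O ⊆ P) :
    MemAVee (insert M P) O ↔
      MemAVee P O ∧ 0 < M ∧ ∀ p ∈ P, p ≤ if 4 ∣ M then M - 5 else M - 4 := by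
  have hM : M ∉ P := fun h => lt_irrefl _ (hP M h)
  have hMO : M ∉ O := fun h => hM (hO h)
  constructor
  · intro h
    refine ⟨memAVee_mono h (Finset.subset_insert _ _) hO fun _ _ => Iff.rfl,
      h.1 M (Finset.mem_insert_self _ _), fun p hp => ?_⟩
    have h4 := h.2.2.2 M (Finset.mem_insert_self _ _) p (Finset.mem_insert_of_mem hp) (hP p hp)
      (fun h => hMO h.2.1)
    split_ifs with hd
    · have := h4.2 (Or.inr hd)
      omega
    · omega
  · rintro ⟨⟨h1, h2, h3, h4⟩, hM0, hb⟩
    refine ⟨?_, h2.trans (Finset.subset_insert _ _), h3, ?_⟩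
    · intro p hp
      rcases Finset.mem_insert.1 hp with rfl | hp
      exacts [hM0, h1 p hp]
    · intro x hx y hy hxy he
      rcases Finset.mem_insert.1 hx with rfl | hx' <;> rcases Finset.mem_insert.1 hy with rfl | hy'
      · omega
      · have := h1 y hy'
        have := hb y hy'
        split_ifs at this with hd
        · omega
        · exact ⟨by omega, fun h => absurd h (by simp [hMO, hd])⟩
      · have := hP x hx'
        omega
      · exact h4 x hx' y hy' hxy he

/-- Adding a new largest part `M` that is overlined. -/
theorem memAVee_insert_insert_iff {P O : Finset ℕ} {M : ℕ} (hP : ∀ p ∈ P, p < M) (hO : O ⊆ P) :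
    MemAVee (insert M P) (insert M O) ↔
      MemAVee P O ∧ (Odd M ∧ 1 < M) ∧ ∀ p ∈ P, p ≤ if M = 5 then 1 else M - 5 := by
  have hM : M ∉ P := fun h => lt_irrefl _ (hP M h)
  have hMO : M ∉ O := fun h => hM (hO h)
  constructor
  · intro h
    refine ⟨memAVee_mono h (Finset.subset_insert _ _) hO fun p hp => ?_,
      h.2.2.1 M (Finset.mem_insert_self _ _), fun p hp => ?_⟩
    · simp [ne_of_lt (hP p hp)]
    · have h0 := h.1 p (Finset.mem_insert_of_mem hp)
      have h4 := h.2.2.2 M (Finset.mem_insert_self _ _) p (Finset.mem_insert_of_mem hp) (hP p hp)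
      have h5 := hP p hp
      by_cases hp1 : M = 5 ∧ p = 1
      · simp [hp1.1, hp1.2]
      · have h6 := (h4 fun h => hp1 ⟨h.1, h.2.2⟩).2 (Or.inl (Finset.mem_insert_self _ _))
        split_ifs <;> omega
  · rintro ⟨⟨h1, h2, h3, h4⟩, hM1, hb⟩
    refine ⟨?_, Finset.insert_subset_insert _ h2, ?_, ?_⟩
    · intro p hp
      rcases Finset.mem_insert.1 hp with rfl | hp
      exacts [by omega, h1 p hp]
    · intro p hp
      rcases Finset.mem_insert.1 hp with rfl | hp
      exacts [hM1, h3 p hp]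
    · intro x hx y hy hxy he
      rcases Finset.mem_insert.1 hx with rfl | hx' <;> rcases Finset.mem_insert.1 hy with rfl | hy'
      · omega
      · have := hb y hy'
        have := h1 y hy'
        have := hP y hy'
        simp only [Finset.mem_insert_self, true_and] at he
        split_ifs at * <;> omega
      · have := hP x hx'
        omega
      · have hxM := ne_of_lt (hP x hx')
        simp only [Finset.mem_insert, hxM, false_or] at he ⊢
        exact h4 x hx' y hy' hxy he

open Classical in
/-- The members of `𝒜_{1̄}^⋁` with all parts at most `N`. -/
noncomputable def boundedAVee (N : ℕ) : Finset (Finset ℕ × Finset ℕ) :=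
  ((Finset.Icc 1 N).powerset ×ˢ (Finset.Icc 1 N).powerset).filter fun s => MemAVee s.1 s.2

theorem mem_boundedAVee {N : ℕ} {s : Finset ℕ × Finset ℕ} :
    s ∈ boundedAVee N ↔ MemAVee s.1 s.2 ∧ ∀ p ∈ s.1, p ≤ N := by
  simp only [boundedAVee, Finset.mem_filter, Finset.mem_product, Finset.mem_powerset]
  constructor
  · rintro ⟨⟨h1, -⟩, h⟩
    exact ⟨h, fun p hp => (Finset.mem_Icc.1 (h1 hp)).2⟩
  · rintro ⟨h, hb⟩
    have : s.1 ⊆ Finset.Icc 1 N := fun p hp => Finset.mem_Icc.2 ⟨h.1 p hp, hb p hp⟩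
    exact ⟨⟨this, h.2.1.trans this⟩, h⟩

section PartGF

variable {R : Type*} [CommRing R] (w v : ℕ → R)

/-- The weight of `(P, O)`, where a part `p` weighs `v p` if it is overlined and `w p` if not. -/
def partWeight (s : Finset ℕ × Finset ℕ) : R := ∏ p ∈ s.1, if p ∈ s.2 then v p else w p

/-- The generating function of the members of `𝒜_{1̄}^⋁` with all parts at most `N`. -/
noncomputable def partGF (N : ℕ) : R := ∑ s ∈ boundedAVee N, partWeight w v s

theorem partGF_zero : partGF w v 0 = 1 := by
  have : boundedAVee 0 = {(∅, ∅)} := by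
    ext ⟨P, O⟩
    simp only [mem_boundedAVee, Finset.mem_singleton, Prod.mk.injEq]
    constructor
    · rintro ⟨⟨h1, h2, -⟩, h⟩
      have hP : P = ∅ := Finset.eq_empty_of_forall_notMem fun p hp => by
        have := h1 p hp
        have := h p hp
        omega
      exact ⟨hP, Finset.subset_empty.1 (hP ▸ h2)⟩
    · rintro ⟨rfl, rfl⟩
      simp [MemAVee]
  simp [partGF, this, partWeight]

theorem partWeight_insert_left {P O : Finset ℕ} {M : ℕ} (hM : M ∉ P) (hO : O ⊆ P) :
    partWeight w v (insert M P, O) = w M * partWeight w v (P, O) := by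
  simp only [partWeight, Finset.prod_insert hM, if_neg fun h => hM (hO h)]

theorem partWeight_insert_insert {P O : Finset ℕ} {M : ℕ} (hM : M ∉ P) :
    partWeight w v (insert M P, insert M O) = v M * partWeight w v (P, O) := by
  simp only [partWeight, Finset.prod_insert hM, if_pos (Finset.mem_insert_self M O)]
  congr 1
  refine Finset.prod_congr rfl fun p hp => ?_
  have : p ≠ M := fun h => hM (h ▸ hp)
  simp [this]

theorem sum_boundedAVee_not_mem (N : ℕ) :
    ∑ s ∈ (boundedAVee (N + 1)).filter (fun s => N + 1 ∉ s.1), partWeight w v s =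
      partGF w v N := by
  refine Finset.sum_congr ?_ fun _ _ => rfl
  ext s
  simp only [Finset.mem_filter, mem_boundedAVee]
  constructor
  · rintro ⟨⟨h, hb⟩, hN⟩
    exact ⟨h, fun p hp => Nat.le_of_lt_succ
      (lt_of_le_of_ne (hb p hp) (ne_of_mem_of_not_mem hp hN))⟩
  · rintro ⟨h, hb⟩
    exact ⟨⟨h, fun p hp => (hb p hp).trans (Nat.le_succ N)⟩, fun hN => by
      have := hb _ hN
      omega⟩

theorem sum_boundedAVee_mem_not_mem (N : ℕ) :
    ∑ s ∈ (boundedAVee (N + 1)).filter (fun s => N + 1 ∈ s.1 ∧ N + 1 ∉ s.2), partWeight w v s =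
      w (N + 1) * partGF w v (if 4 ∣ N + 1 then N - 4 else N - 3) := by
  rw [partGF, Finset.mul_sum]
  have hN : (if 4 ∣ N + 1 then N - 4 else N - 3) =
    if 4 ∣ N + 1 then N + 1 - 5 else N + 1 - 4 := by split_ifs <;> omega
  have hlt : ∀ p, (p ≤ if 4 ∣ N + 1 then N + 1 - 5 else N + 1 - 4) → p < N + 1 := by
    intro p hp
    split_ifs at hp <;> omega
  rw [hN]
  refine Finset.sum_bij' (fun s _ => (s.1.erase (N + 1), s.2))
    (fun s _ => (insert (N + 1) s.1, s.2)) ?_ ?_ ?_ ?_ ?_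
  · rintro ⟨P, O⟩ h
    simp only [Finset.mem_filter, mem_boundedAVee] at h ⊢
    obtain ⟨⟨h, hb⟩, hP, hO⟩ := h
    have := (memAVee_insert_left_iff (P := P.erase (N + 1)) (O := O) (M := N + 1)
      (fun p hp => lt_of_le_of_ne (hb p (Finset.mem_of_mem_erase hp)) (Finset.ne_of_mem_erase hp))
      (fun p hp => Finset.mem_erase.2 ⟨ne_of_mem_of_not_mem hp hO, h.2.1 hp⟩)).1
      (by rwa [Finset.insert_erase hP])
    exact ⟨this.1, this.2.2⟩
  · rintro ⟨P, O⟩ h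
    simp only [Finset.mem_filter, mem_boundedAVee] at h ⊢
    obtain ⟨h, hb⟩ := h
    refine ⟨⟨(memAVee_insert_left_iff (fun p hp => hlt p (hb p hp)) h.2.1).2
      ⟨h, Nat.succ_pos N, hb⟩, ?_⟩, Finset.mem_insert_self _ _,
      fun hO => lt_irrefl _ (hlt _ (hb _ (h.2.1 hO)))⟩
    intro p hp
    rcases Finset.mem_insert.1 hp with rfl | hp
    exacts [le_rfl, (hlt p (hb p hp)).le]
  · rintro ⟨P, O⟩ h
    simp only [Finset.mem_filter] at h
    simp [Finset.insert_erase h.2.1]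
  · rintro ⟨P, O⟩ h
    have h := (mem_boundedAVee.1 h).2
    simp [Finset.erase_insert fun hN => lt_irrefl _ (hlt _ (h _ hN))]
  · rintro ⟨P, O⟩ h
    simp only [Finset.mem_filter, mem_boundedAVee] at h
    rw [← partWeight_insert_left w v (Finset.notMem_erase _ _)
      (fun p hp => Finset.mem_erase.2 ⟨ne_of_mem_of_not_mem hp h.2.2, h.1.1.2.1 hp⟩),
      Finset.insert_erase h.2.1]

theorem sum_boundedAVee_mem_mem (N : ℕ) :
    ∑ s ∈ (boundedAVee (N + 1)).filter (fun s => N + 1 ∈ s.1 ∧ N + 1 ∈ s.2), partWeight w v s =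
      if Odd (N + 1) ∧ 1 < N + 1 then v (N + 1) * partGF w v (if N = 4 then 1 else N - 4)
      else 0 := by
  by_cases hodd : Odd (N + 1) ∧ 1 < N + 1
  swap
  · rw [if_neg hodd]
    refine Finset.sum_eq_zero fun s hs => ?_
    simp only [Finset.mem_filter, mem_boundedAVee] at hs
    exact absurd (hs.1.1.2.2.1 _ hs.2.2) hodd
  rw [if_pos hodd, partGF, Finset.mul_sum]
  have hN : (if N = 4 then 1 else N - 4) = if N + 1 = 5 then 1 else N + 1 - 5 := by
    split_ifs <;> omega
  have hlt : ∀ p, (p ≤ if N + 1 = 5 then 1 else N + 1 - 5) → p < N + 1 := by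
    intro p hp
    split_ifs at hp <;> omega
  rw [hN]
  refine Finset.sum_bij' (fun s _ => (s.1.erase (N + 1), s.2.erase (N + 1)))
    (fun s _ => (insert (N + 1) s.1, insert (N + 1) s.2)) ?_ ?_ ?_ ?_ ?_
  · rintro ⟨P, O⟩ h
    simp only [Finset.mem_filter, mem_boundedAVee] at h ⊢
    obtain ⟨⟨h, hb⟩, hP, hO⟩ := h
    have := (memAVee_insert_insert_iff (P := P.erase (N + 1)) (O := O.erase (N + 1)) (M := N + 1)
      (fun p hp => lt_of_le_of_ne (hb p (Finset.mem_of_mem_erase hp)) (Finset.ne_of_mem_erase hp))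
      (Finset.erase_subset_erase _ h.2.1)).1
      (by rwa [Finset.insert_erase hP, Finset.insert_erase hO])
    exact ⟨this.1, this.2.2⟩
  · rintro ⟨P, O⟩ h
    simp only [Finset.mem_filter, mem_boundedAVee] at h ⊢
    obtain ⟨h, hb⟩ := h
    refine ⟨⟨(memAVee_insert_insert_iff (fun p hp => hlt p (hb p hp)) h.2.1).2
      ⟨h, hodd, hb⟩, ?_⟩, Finset.mem_insert_self _ _, Finset.mem_insert_self _ _⟩
    intro p hp
    rcases Finset.mem_insert.1 hp with rfl | hp
    exacts [le_rfl, (hlt p (hb p hp)).le]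
  · rintro ⟨P, O⟩ h
    simp only [Finset.mem_filter] at h
    simp [Finset.insert_erase h.2.1, Finset.insert_erase h.2.2]
  · rintro ⟨P, O⟩ h
    obtain ⟨h', h⟩ := mem_boundedAVee.1 h
    have hN : N + 1 ∉ P := fun hN => lt_irrefl _ (hlt _ (h _ hN))
    simp [Finset.erase_insert hN, Finset.erase_insert fun hO => hN (h'.2.1 hO)]
  · rintro ⟨P, O⟩ h
    simp only [Finset.mem_filter, mem_boundedAVee] at h
    rw [← partWeight_insert_insert w v (Finset.notMem_erase _ _),
      Finset.insert_erase h.2.1, Finset.insert_erase h.2.2]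

/-- The recurrence obtained by removing the largest part. -/
theorem partGF_succ (N : ℕ) : partGF w v (N + 1) =
    partGF w v N + w (N + 1) * partGF w v (if 4 ∣ N + 1 then N - 4 else N - 3) +
      if Odd (N + 1) ∧ 1 < N + 1 then v (N + 1) * partGF w v (if N = 4 then 1 else N - 4)
      else 0 := by
  rw [← sum_boundedAVee_mem_mem, ← sum_boundedAVee_mem_not_mem,
    ← sum_boundedAVee_not_mem w v N, add_assoc]
  have h := Finset.sum_filter_add_sum_filter_not
    ((boundedAVee (N + 1)).filter fun s => N + 1 ∈ s.1) (fun s => N + 1 ∉ s.2) (partWeight w v)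
  simp only [Finset.filter_filter, not_not] at h
  rw [h, partGF, ← Finset.sum_filter_add_sum_filter_not (boundedAVee (N + 1))
    (fun s => N + 1 ∉ s.1)]
  simp only [not_not]

end PartGF

section Colour

variable {R : Type*} [CommRing R] {w v : ℕ → R} {a b c Q : R}

theorem partGF_four_mul_add_two (hb : ∀ k, w (4 * k + 2) = b * Q ^ k) (k : ℕ) :
    partGF w v (4 * k + 2) = partGF w v (4 * k + 1) + b * Q ^ k * partGF w v (4 * k - 2) := by
  rw [partGF_succ, if_neg (by omega : ¬4 ∣ 4 * k + 1 + 1),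
    if_neg (by rw [Nat.odd_iff]; omega), hb, add_zero]
  rfl

theorem partGF_four_mul_add_three (hc : ∀ k, w (4 * k + 3) = c * Q ^ k)
    (hab : ∀ k, v (4 * k + 3) = a * b * Q ^ k) (k : ℕ) :
    partGF w v (4 * k + 3) = partGF w v (4 * k + 2) + c * Q ^ k * partGF w v (4 * k - 1) +
      a * b * Q ^ k * partGF w v (4 * k - 2) := by
  rw [partGF_succ, if_neg (by omega : ¬4 ∣ 4 * k + 2 + 1),
    if_pos (by rw [Nat.odd_iff]; omega), if_neg (by omega), hc, hab]
  rfl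

theorem partGF_four_mul_add_four (hac : ∀ k, w (4 * k + 4) = a * c * Q ^ k) (k : ℕ) :
    partGF w v (4 * k + 4) = partGF w v (4 * k + 3) + a * c * Q ^ k * partGF w v (4 * k - 1) := by
  rw [partGF_succ, if_pos (by omega : 4 ∣ 4 * k + 3 + 1),
    if_neg (by rw [Nat.odd_iff]; omega), hac, add_zero]
  rfl

theorem partGF_four_mul_add_five (ha : ∀ k, w (4 * k + 1) = a * Q ^ k)
    (hbc : ∀ k, v (4 * k + 5) = b * c * Q ^ k) (k : ℕ) :
    partGF w v (4 * k + 5) = partGF w v (4 * k + 4) + a * Q ^ (k + 1) * partGF w v (4 * k + 1) +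
      b * c * Q ^ k * partGF w v (if k = 0 then 1 else 4 * k) := by
  have h : (if 4 * k + 4 = 4 then 1 else 4 * k + 4 - 4) = if k = 0 then 1 else 4 * k := by
    split_ifs <;> omega
  rw [partGF_succ, if_neg (by omega : ¬4 ∣ 4 * k + 4 + 1),
    if_pos (by rw [Nat.odd_iff]; omega), h, hbc, show 4 * k + 4 + 1 = 4 * (k + 1) + 1 by ring, ha]
  rfl

theorem partGF_one (ha : ∀ k, w (4 * k + 1) = a * Q ^ k) : partGF w v 1 = 1 + a := by
  have := partGF_succ w v 0
  simpa [partGF_zero, ha 0] using this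

theorem partGF_colour_eq (ha : ∀ k, w (4 * k + 1) = a * Q ^ k)
    (hb : ∀ k, w (4 * k + 2) = b * Q ^ k) (hc : ∀ k, w (4 * k + 3) = c * Q ^ k)
    (hac : ∀ k, w (4 * k + 4) = a * c * Q ^ k) (hab : ∀ k, v (4 * k + 3) = a * b * Q ^ k)
    (hbc : ∀ k, v (4 * k + 5) = b * c * Q ^ k) (k : ℕ) :
    colourF a b c Q (k + 1) =
        partGF w v (4 * k + 2) + c * Q ^ k * partGF w v (4 * k - 1) ∧
      colourZ a b c Q k = (a * c + b * c) * partGF w v (4 * k - 1) +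
        a * b * (1 - c) * partGF w v (4 * k - 2) := by
  have h2 := partGF_four_mul_add_two (v := v) hb
  have h3 := partGF_four_mul_add_three hc hab
  have h4 := partGF_four_mul_add_four (v := v) hac
  have h5 := partGF_four_mul_add_five ha hbc
  have s0 := partGF_zero w v
  have s1 := partGF_one (v := v) ha
  have base0 : colourF a b c Q (0 + 1) =
        partGF w v (4 * 0 + 2) + c * Q ^ 0 * partGF w v (4 * 0 - 1) ∧
      colourZ a b c Q 0 = (a * c + b * c) * partGF w v (4 * 0 - 1) +
        a * b * (1 - c) * partGF w v (4 * 0 - 2) := by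
    rw [h2]
    simp only [mul_zero, zero_add, Nat.zero_sub, s0, s1, colourF_one, colourZ_zero]
    constructor <;> ring
  have s2 := h2 0
  have s3 := h3 0
  have s4 := h4 0
  have s5 := h5 0
  have s6 := h2 1
  have s7 := h3 1
  have s8 := h4 1
  have s9 := h5 1
  have s10 := h2 2
  simp only [mul_zero, zero_add, Nat.zero_sub, mul_one, Nat.reduceMul, Nat.reduceSub, Nat.reduceAdd,
    if_true, one_ne_zero, if_false, pow_zero, pow_one, s0, s1] at s2 s3 s4 s5 s6 s7 s8 s9 s10
  have base1 : colourF a b c Q (1 + 1) =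
        partGF w v (4 * 1 + 2) + c * Q ^ 1 * partGF w v (4 * 1 - 1) ∧
      colourZ a b c Q 1 = (a * c + b * c) * partGF w v (4 * 1 - 1) +
        a * b * (1 - c) * partGF w v (4 * 1 - 2) := by
    have e1 := colourF_add_two a b c Q 0
    simp only [zero_add] at e1
    simp only [e1, colourZ_zero, colourF_zero, colourF_one, colourZ_one, pow_zero,
      pow_one, mul_one, Nat.reduceAdd, Nat.reduceSub, s2, s3, s4, s5, s6]
    constructor <;> ring
  have base2 : colourF a b c Q (2 + 1) =
        partGF w v (4 * 2 + 2) + c * Q ^ 2 * partGF w v (4 * 2 - 1) ∧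
      colourZ a b c Q 2 = (a * c + b * c) * partGF w v (4 * 2 - 1) +
        a * b * (1 - c) * partGF w v (4 * 2 - 2) := by
    have e1 := colourF_add_two a b c Q 0
    have e2 := colourF_add_two a b c Q 1
    have e3 := colourZ_add_two a b c Q 0
    simp only [Nat.reduceAdd, zero_add] at e1 e2 e3
    simp only [e2, e3, e1, colourZ_zero, colourF_zero, zero_add, colourF_one, colourZ_one,
      Nat.reduceMul, Nat.reduceAdd, Nat.reduceSub, s2, s3, s4, s5, s6, s7, s8, s9, s10]
    constructor <;> ring
  suffices H : ∀ k,
      (colourF a b c Q (k + 1) = partGF w v (4 * k + 2) + c * Q ^ k * partGF w v (4 * k - 1) ∧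
        colourZ a b c Q k = (a * c + b * c) * partGF w v (4 * k - 1) +
          a * b * (1 - c) * partGF w v (4 * k - 2)) ∧
      (colourF a b c Q (k + 2) = partGF w v (4 * k + 6) +
          c * Q ^ (k + 1) * partGF w v (4 * k + 3) ∧
        colourZ a b c Q (k + 1) = (a * c + b * c) * partGF w v (4 * k + 3) +
          a * b * (1 - c) * partGF w v (4 * k + 2)) ∧
      (colourF a b c Q (k + 3) = partGF w v (4 * k + 10) +
          c * Q ^ (k + 2) * partGF w v (4 * k + 7) ∧
        colourZ a b c Q (k + 2) = (a * c + b * c) * partGF w v (4 * k + 7) +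
          a * b * (1 - c) * partGF w v (4 * k + 6)) from (H k).1
  intro k
  induction k with
  | zero => exact ⟨base0, base1, base2⟩
  | succ k ih =>
    obtain ⟨⟨hF₁, -⟩, ⟨hF₂, hZ₁⟩, hF₃, hZ₂⟩ := ih
    have t4 := h4 k
    have t6 : partGF w v (4 * k + 6) = partGF w v (4 * k + 5) +
        b * Q ^ (k + 1) * partGF w v (4 * k + 2) := h2 (k + 1)
    have t7 : partGF w v (4 * k + 7) = partGF w v (4 * k + 6) +
        c * Q ^ (k + 1) * partGF w v (4 * k + 3) +
        a * b * Q ^ (k + 1) * partGF w v (4 * k + 2) := h3 (k + 1)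
    have t8 : partGF w v (4 * k + 8) = partGF w v (4 * k + 7) +
        a * c * Q ^ (k + 1) * partGF w v (4 * k + 3) := h4 (k + 1)
    have t9 : partGF w v (4 * k + 9) = partGF w v (4 * k + 8) +
        a * Q ^ (k + 2) * partGF w v (4 * k + 5) +
        b * c * Q ^ (k + 1) * partGF w v (4 * k + 4) := h5 (k + 1)
    have t10 : partGF w v (4 * k + 10) = partGF w v (4 * k + 9) +
        b * Q ^ (k + 2) * partGF w v (4 * k + 6) := h2 (k + 2)
    have t11 : partGF w v (4 * k + 11) = partGF w v (4 * k + 10) +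
        c * Q ^ (k + 2) * partGF w v (4 * k + 7) +
        a * b * Q ^ (k + 2) * partGF w v (4 * k + 6) := h3 (k + 2)
    have t12 : partGF w v (4 * k + 12) = partGF w v (4 * k + 11) +
        a * c * Q ^ (k + 2) * partGF w v (4 * k + 7) := h4 (k + 2)
    have t13 : partGF w v (4 * k + 13) = partGF w v (4 * k + 12) +
        a * Q ^ (k + 3) * partGF w v (4 * k + 9) +
        b * c * Q ^ (k + 2) * partGF w v (4 * k + 8) := h5 (k + 2)
    have t14 : partGF w v (4 * k + 14) = partGF w v (4 * k + 13) +
        b * Q ^ (k + 3) * partGF w v (4 * k + 10) := h2 (k + 3)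
    have eF₃ : colourF a b c Q (k + 3) = _ := colourF_add_two a b c Q (k + 1)
    have eF₄ : colourF a b c Q (k + 4) = _ := colourF_add_two a b c Q (k + 2)
    have eZ₃ : colourZ a b c Q (k + 3) = _ := colourZ_add_two a b c Q (k + 1)
    simp only [add_assoc, Nat.reduceAdd] at eF₃ eF₄ eZ₃
    refine ⟨⟨hF₂, hZ₁⟩, ⟨hF₃, hZ₂⟩, ?_, ?_⟩
    · change colourF a b c Q (k + 4) = partGF w v (4 * k + 14) +
        c * Q ^ (k + 3) * partGF w v (4 * k + 11)
      rw [eF₄, hF₃, hF₂, hZ₂, t14, t13, t12, t11, t10, t9, t8, t7, t6, t4]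
      ring
    · change colourZ a b c Q (k + 3) = (a * c + b * c) * partGF w v (4 * k + 11) +
        a * b * (1 - c) * partGF w v (4 * k + 10)
      rw [hF₃, hF₂, hF₁, hZ₁, t10, t9, t8, t7, t6, t4] at eF₃
      rw [eZ₃, hF₃, hF₂, hZ₁, t11, t10, t9, t8, t7, t6, t4]
      linear_combination a * b * c * eF₃

end Colour

section Limit

open PowerSeries

variable {A : Type*} [CommRing A]

theorem PowerSeries.eq_zero_of_forall_X_pow_dvd {f : A⟦X⟧} (h : ∀ n, X ^ n ∣ f) : f = 0 := by
  ext n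
  exact X_pow_dvd_iff.1 (h (n + 1)) n n.lt_succ_self

/-- The `X`-adic limit of the sequence `colourF a b c Q`, when `X ∣ Q`. -/
noncomputable def colourLim (a b c Q : A⟦X⟧) : A⟦X⟧ :=
  PowerSeries.mk fun n => coeff n (colourF a b c Q (n + 2))

theorem colourLim_rotate (a b c Q : A⟦X⟧) : colourLim a b c Q = colourLim c a b Q := by
  simp only [colourLim, colourF_rotate a b]

variable {a b c Q : A⟦X⟧}

theorem X_pow_dvd_colourF_sub_colourLim (hQ : X ∣ Q) (n : ℕ) :
    X ^ n ∣ colourF a b c Q (n + 1) - colourLim a b c Q := by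
  have step (n : ℕ) : X ^ n ∣ colourF a b c Q (n + 2) - colourF a b c Q (n + 1) := by
    refine (pow_dvd_pow_of_dvd hQ n).trans
      ⟨(a + b + c) * Q * colourF a b c Q (n + 1) + a * b * c * colourF a b c Q n +
        (1 - Q ^ (n + 1)) * colourZ a b c Q n, ?_⟩
    rw [colourF_add_two]
    ring
  rw [X_pow_dvd_iff]
  intro i hi
  rw [map_sub, colourLim, coeff_mk, sub_eq_zero]
  induction n, hi using Nat.le_induction with
  | base => rfl
  | succ n hn ih =>
    rw [← ih, ← sub_eq_zero, ← map_sub]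
    exact X_pow_dvd_iff.1 (step n) i hn

theorem X_pow_dvd_colourZ_sub_colourLim (hQ : X ∣ Q) (n : ℕ) :
    X ^ n ∣ colourZ a b c Q (n + 2) -
      (a * b + a * c + b * c - a * b * c) * colourLim a b c Q := by
  obtain ⟨u, hu⟩ := (pow_dvd_pow X n.le_succ).trans
    (X_pow_dvd_colourF_sub_colourLim (a := a) (b := b) (c := c) hQ (n + 1))
  obtain ⟨r, hr⟩ := pow_dvd_pow_of_dvd hQ n
  refine ⟨(a * b + a * c + b * c - a * b * c) * u +
    r * (a * b * c * (a + b + c - 1) * Q * colourF a b c Q (n + 1) -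
      a * b * c * Q ^ (n + 1) * colourZ a b c Q n), ?_⟩
  rw [colourZ_add_two]
  linear_combination (a * b + a * c + b * c - a * b * c) * hu +
    (a * b * c * (a + b + c - 1) * Q * colourF a b c Q (n + 1) -
      a * b * c * Q ^ (n + 1) * colourZ a b c Q n) * hr

theorem colourLim_eq_one_add_mul [IsDomain A] (hQ : X ∣ Q) (hb : b + a * Q * c ≠ 0)
    (hc : c + a * Q * b ≠ 0) : colourLim a b c Q = (1 + a) * colourLim (a * Q) b c Q := by
  refine mul_left_cancel₀ (mul_ne_zero hb hc) (sub_eq_zero.1 ?_)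
  refine PowerSeries.eq_zero_of_forall_X_pow_dvd fun n => ?_
  obtain ⟨r, hr⟩ := pow_dvd_pow_of_dvd hQ n
  obtain ⟨u, hu⟩ := (pow_dvd_pow X (Nat.le_add_right n 2)).trans
    (X_pow_dvd_colourF_sub_colourLim (a := a) (b := b) (c := c) hQ (n + 2))
  obtain ⟨u₁, hu₁⟩ := (pow_dvd_pow X (Nat.le_add_right n 2)).trans
    (X_pow_dvd_colourF_sub_colourLim (a := a * Q) (b := b) (c := c) hQ (n + 2))
  obtain ⟨u₂, hu₂⟩ := (pow_dvd_pow X (Nat.le_add_right n 1)).trans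
    (X_pow_dvd_colourF_sub_colourLim (a := a * Q) (b := b) (c := c) hQ (n + 1))
  obtain ⟨z, hz⟩ := X_pow_dvd_colourZ_sub_colourLim (a := a * Q) (b := b) (c := c) hQ n
  have key := (colour_contiguous a b c Q (n + 1)).1
  simp only [add_assoc, Nat.reduceAdd] at key hu hu₁ hu₂
  obtain ⟨D, hD⟩ : ∃ D, D = (b + a * Q * c) * (c + a * Q * b) := ⟨_, rfl⟩
  obtain ⟨B, hB⟩ : ∃ B, B = b * c * (a * Q - 1) * (a * Q + b + c - 1) := ⟨_, rfl⟩
  obtain ⟨Y, hY⟩ : ∃ Y, Y = B * colourF (a * Q) b c Q (n + 2) +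
    (b + c) * colourZ (a * Q) b c Q (n + 2) -
    b * c * (a * Q - 1) * Q ^ (n + 1) * colourZ (a * Q) b c Q (n + 1) := ⟨_, rfl⟩
  have hDB : D = B + (b + c) *
      (a * Q * b + a * Q * c + b * c - a * Q * b * c) := by
    rw [hD, hB]
    ring
  rw [← hD, ← add_assoc (a * Q), ← hB, ← hY] at key
  rw [← hD]
  refine ⟨-D * u + D * u₁ + a * (B * u₂ + (b + c) * z) -
    a * r * (Q ^ 3 * Y + b * c * (a * Q - 1) * Q * colourZ (a * Q) b c Q (n + 1)), ?_⟩
  linear_combination key - D * hu + D * hu₁ + a * B * hu₂ + a * (b + c) * hz -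
    a * (Q ^ 3 * Y + b * c * (a * Q - 1) * Q * colourZ (a * Q) b c Q (n + 1)) * hr + a * hY -
    a * colourLim (a * Q) b c Q * hDB

theorem X_pow_dvd_colourLim_sub_one {N : ℕ} (hQ : X ∣ Q) (ha : X ^ N ∣ a) (hb : X ^ N ∣ b)
    (hc : X ^ N ∣ c) : X ^ N ∣ colourLim a b c Q - 1 := by
  have hZ (n : ℕ) : X ^ N ∣ colourZ a b c Q n := by
    have h₂ : X ^ N ∣ a * b + a * c + b * c :=
      ((ha.mul_right b).add (ha.mul_right c)).add (hb.mul_right c)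
    have h₃ : X ^ N ∣ a * b * c := (ha.mul_right b).mul_right c
    match n with
    | 0 => exact h₂.sub h₃
    | 1 => exact (h₂.mul_left _).sub (h₃.mul_left _)
    | n + 2 =>
      rw [colourZ_add_two]
      exact (((h₂.sub h₃).mul_right _).add (((h₃.mul_right _).mul_right _).mul_right _)).sub
        ((h₃.mul_right _).mul_right _)
  have hF (n : ℕ) : X ^ N ∣ colourF a b c Q (n + 1) - 1 := by
    induction n with
    | zero =>
      rw [zero_add, colourF_one, add_sub_cancel_left]
      exact (ha.add hb).add hc
    | succ n ih =>
      have : colourF a b c Q (n + 2) - 1 = (colourF a b c Q (n + 1) - 1) +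
        (a + b + c) * (Q ^ (n + 1) * colourF a b c Q (n + 1)) +
        a * (b * c * (Q ^ n * colourF a b c Q n)) +
        (1 - Q ^ (n + 1)) * Q ^ n * colourZ a b c Q n := by
        rw [colourF_add_two]
        ring
      rw [this]
      exact ((ih.add (((ha.add hb).add hc).mul_right _)).add (ha.mul_right _)).add
        ((hZ n).mul_left _)
  rw [← sub_sub_sub_cancel_left _ _ (colourF a b c Q (N + 1))]
  exact (hF N).sub (X_pow_dvd_colourF_sub_colourLim hQ N)

end Limit

section Count

open Polynomial PowerSeries

/-- The monomial `x ^ m * y ^ l * q ^ n` in `ℤ[x][y]⟦q⟧`. -/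
noncomputable def trimonomial (n m l : ℕ) : ℤ[X][X]⟦X⟧ :=
  PowerSeries.monomial n (Polynomial.monomial l (Polynomial.monomial m 1))

/-- The coefficient of `x ^ m * y ^ l * q ^ n` in an element of `ℤ[x][y]⟦q⟧`. -/
noncomputable def tricoeff (n m l : ℕ) : ℤ[X][X]⟦X⟧ →+ ℤ :=
  ((Polynomial.lcoeff ℤ m).toAddMonoidHom.comp (Polynomial.lcoeff ℤ[X] l).toAddMonoidHom).comp
    (PowerSeries.coeff n).toAddMonoidHom

theorem tricoeff_apply (n m l : ℕ) (f : ℤ[X][X]⟦X⟧) :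
    tricoeff n m l f = ((PowerSeries.coeff n f).coeff l).coeff m := rfl

theorem tricoeff_trimonomial (n m l n' m' l' : ℕ) :
    tricoeff n m l (trimonomial n' m' l') = if n' = n ∧ m' = m ∧ l' = l then 1 else 0 := by
  rw [tricoeff_apply, trimonomial, PowerSeries.coeff_monomial]
  by_cases hn : n = n'
  · by_cases hl : l' = l
    · simp [hn, hl, Polynomial.coeff_monomial]
    · simp [hn, hl, Polynomial.coeff_monomial]
  · simp [hn, Ne.symm hn]

theorem trimonomial_mul (n m l n' m' l' : ℕ) : trimonomial n m l * trimonomial n' m' l' =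
    trimonomial (n + n') (m + m') (l + l') := by
  simp [trimonomial, PowerSeries.monomial_mul_monomial, Polynomial.monomial_mul_monomial]

theorem trimonomial_zero : trimonomial 0 0 0 = 1 := by
  simp [trimonomial]

theorem trimonomial_mul_X_pow (n m l k : ℕ) :
    trimonomial n m l * PowerSeries.X ^ k = trimonomial (n + k) m l := by
  rw [PowerSeries.X_pow_eq, trimonomial, trimonomial, PowerSeries.monomial_mul_monomial, mul_one]

theorem X_pow_dvd_trimonomial {N n : ℕ} (h : N ≤ n) (m l : ℕ) :
    PowerSeries.X ^ N ∣ trimonomial n m l := by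
  obtain ⟨k, rfl⟩ := Nat.exists_eq_add_of_le' h
  exact ⟨trimonomial k m l, by rw [mul_comm, trimonomial_mul_X_pow]⟩

theorem trimonomial_add_ne_zero (n m l n' m' l' : ℕ) :
    trimonomial n m l + trimonomial n' m' l' ≠ 0 := by
  intro h
  have := congrArg (tricoeff n m l) h
  rw [map_add, tricoeff_trimonomial, tricoeff_trimonomial, map_zero, if_pos ⟨rfl, rfl, rfl⟩] at this
  split_ifs at this <;> omega

theorem prod_trimonomial {ι : Type*} (s : Finset ι) (f g h : ι → ℕ) :
    ∏ i ∈ s, trimonomial (f i) (g i) (h i) =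
      trimonomial (∑ i ∈ s, f i) (∑ i ∈ s, g i) (∑ i ∈ s, h i) := by
  classical
  induction s using Finset.induction_on with
  | empty => simp [trimonomial_zero]
  | insert i s hi ih => simp [Finset.prod_insert hi, Finset.sum_insert hi, ih, trimonomial_mul]

theorem tricoeff_sum_trimonomial {ι : Type*} (s : Finset ι) (f g h : ι → ℕ) (n m l : ℕ) :
    tricoeff n m l (∑ i ∈ s, trimonomial (f i) (g i) (h i)) =
      {i ∈ s | f i = n ∧ g i = m ∧ h i = l}.card := by
  simp [map_sum, tricoeff_trimonomial]

theorem tricoeff_congr {N n : ℕ} {f g : ℤ[X][X]⟦X⟧} (h : PowerSeries.X ^ N ∣ f - g) (hn : n < N)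
    (m l : ℕ) : tricoeff n m l f = tricoeff n m l g := by
  have := PowerSeries.X_pow_dvd_iff.1 h n hn
  rw [map_sub, sub_eq_zero] at this
  rw [tricoeff_apply, tricoeff_apply, this]

/-- The weight of a part that is not overlined. -/
noncomputable def plainWeight (p : ℕ) : ℤ[X][X]⟦X⟧ :=
  trimonomial p ((if p % 2 = 1 then 1 else 0) + 2 * if p % 4 = 0 then 1 else 0)
    (if p % 4 = 2 then 1 else 0)

/-- The weight of an overlined part. -/
noncomputable def overWeight (p : ℕ) : ℤ[X][X]⟦X⟧ := trimonomial p 1 1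

theorem partWeight_eq_trimonomial {P O : Finset ℕ} (h : MemAVee P O) :
    partWeight plainWeight overWeight (P, O) =
      trimonomial (P.sum id) (countMod 1 2 P + 2 * countMod 0 4 P) (countMod 2 4 P + O.card) := by
  obtain ⟨-, hO, hodd, -⟩ := h
  have hcard : O.card = ∑ p ∈ P, if p ∈ O then 1 else 0 := by
    rw [← Finset.card_filter, Finset.filter_mem_eq_inter, Finset.inter_eq_right.2 hO]
  rw [partWeight, hcard, countMod, countMod, countMod, Finset.card_filter, Finset.card_filter,
    Finset.card_filter, Finset.mul_sum, ← Finset.sum_add_distrib, ← Finset.sum_add_distrib,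
    ← prod_trimonomial]
  refine Finset.prod_congr rfl fun p _ => ?_
  dsimp only [id]
  by_cases hp : p ∈ O
  · have := Nat.odd_iff.1 (hodd p hp).1
    rw [if_pos hp, if_pos hp, overWeight, if_pos this, if_neg (by omega), if_neg (by omega),
      mul_zero, add_zero, zero_add]
  · rw [if_neg hp, if_neg hp, add_zero, plainWeight]

theorem tricoeff_partGF {n N : ℕ} (h : n ≤ N) (m l : ℕ) :
    tricoeff n m l (partGF plainWeight overWeight N) = Acount n m l := by
  have : partGF plainWeight overWeight N = ∑ s ∈ boundedAVee N, trimonomial (s.1.sum id)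
      (countMod 1 2 s.1 + 2 * countMod 0 4 s.1) (countMod 2 4 s.1 + s.2.card) :=
    Finset.sum_congr rfl fun s hs => partWeight_eq_trimonomial (mem_boundedAVee.1 hs).1
  rw [this, tricoeff_sum_trimonomial, Acount, ← Set.ncard_coe_finset]
  congr 2
  ext s
  simp only [Finset.coe_filter, Set.mem_ofPred_eq, mem_boundedAVee]
  constructor
  · rintro ⟨⟨h₁, -⟩, h₂⟩
    exact ⟨h₁, h₂⟩
  · rintro ⟨h₁, h₂⟩
    refine ⟨⟨h₁, fun p hp => ?_⟩, h₂⟩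
    exact (Finset.single_le_sum (f := id) (fun _ _ => Nat.zero_le _) hp).trans (h₂.1.trans_le h)

theorem tricoeff_prod_one_add {n N : ℕ} (h : n < N) (m l : ℕ) :
    tricoeff n m l (∏ p ∈ Finset.range N with ¬4 ∣ p, (1 + plainWeight p)) = Bcount n m l := by
  have hw (S : Finset ℕ) (hS : S ∈ ({p ∈ Finset.range N | ¬4 ∣ p}).powerset) :
      ∏ p ∈ S, plainWeight p = trimonomial (S.sum id) (S.filter fun s => Odd s).card
        (S.filter fun s => Even s).card := by
    rw [Finset.card_filter, Finset.card_filter, ← prod_trimonomial]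
    refine Finset.prod_congr rfl fun p hp => ?_
    have hp4 := (Finset.mem_filter.1 (Finset.mem_powerset.1 hS hp)).2
    simp only [plainWeight, Nat.odd_iff, Nat.even_iff, id]
    congr 1
    · rw [if_neg (by omega : ¬p % 4 = 0), mul_zero, add_zero]
    · exact if_congr (by omega) rfl rfl
  rw [Finset.prod_one_add, Finset.sum_congr rfl hw, tricoeff_sum_trimonomial, Bcount,
    ← Set.ncard_coe_finset]
  congr 2
  ext S
  simp only [Finset.coe_filter, Set.mem_ofPred_eq, Finset.mem_powerset]
  constructor
  · rintro ⟨h₁, h₂⟩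
    refine ⟨fun p hp => ?_, h₂⟩
    have := (Finset.mem_filter.1 (h₁ hp)).2
    exact ⟨Nat.pos_of_ne_zero (by rintro rfl; simp at this), this⟩
  · rintro ⟨h₁, h₂⟩
    refine ⟨fun p hp => ?_, h₂⟩
    rw [Finset.mem_filter, Finset.mem_range]
    have := Finset.single_le_sum (f := id) (fun _ _ => Nat.zero_le _) hp
    exact ⟨(this.trans h₂.1.le).trans_lt h, (h₁ p hp).2⟩

theorem colourLim_trimonomial (K : ℕ) :
    colourLim (trimonomial 1 1 0) (trimonomial 2 0 1) (trimonomial 3 1 0) (PowerSeries.X ^ 4) =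
      (∏ p ∈ Finset.range (4 * K) with ¬4 ∣ p, (1 + plainWeight p)) *
        colourLim (trimonomial (4 * K + 1) 1 0) (trimonomial (4 * K + 2) 0 1)
          (trimonomial (4 * K + 3) 1 0) (PowerSeries.X ^ 4) := by
  have hX : (PowerSeries.X : ℤ[X][X]⟦X⟧) ∣ PowerSeries.X ^ 4 := dvd_pow_self _ four_ne_zero
  have shift (n m l n₁ m₁ l₁ n₂ m₂ l₂ : ℕ) :
      colourLim (trimonomial n m l) (trimonomial n₁ m₁ l₁) (trimonomial n₂ m₂ l₂)
        (PowerSeries.X ^ 4) = (1 + trimonomial n m l) * colourLim (trimonomial (n + 4) m l)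
          (trimonomial n₁ m₁ l₁) (trimonomial n₂ m₂ l₂) (PowerSeries.X ^ 4) := by
    rw [colourLim_eq_one_add_mul hX, trimonomial_mul_X_pow]
    all_goals
      rw [trimonomial_mul_X_pow, trimonomial_mul]
      exact trimonomial_add_ne_zero _ _ _ _ _ _
  induction K with
  | zero => simp
  | succ K ih =>
    rw [ih, shift, colourLim_rotate, shift, colourLim_rotate, shift, colourLim_rotate,
      Finset.prod_filter, Finset.prod_filter, mul_add, mul_one, Finset.prod_range_succ,
      Finset.prod_range_succ, Finset.prod_range_succ, Finset.prod_range_succ]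
    have h₁ : plainWeight (4 * K + 1) = trimonomial (4 * K + 1) 1 0 := by
      rw [plainWeight]
      congr 1 <;> split_ifs <;> omega
    have h₂ : plainWeight (4 * K + 2) = trimonomial (4 * K + 2) 0 1 := by
      rw [plainWeight]
      congr 1 <;> split_ifs <;> omega
    have h₃ : plainWeight (4 * K + 3) = trimonomial (4 * K + 3) 1 0 := by
      rw [plainWeight]
      congr 1 <;> split_ifs <;> omega
    rw [if_neg (by omega), if_pos (by omega), if_pos (by omega), if_pos (by omega), h₁, h₂, h₃]
    ring_nf

theorem partGF_four_mul_sub_colourLim (k : ℕ) : PowerSeries.X ^ k ∣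
    partGF plainWeight overWeight (4 * k + 2) - colourLim (trimonomial 1 1 0) (trimonomial 2 0 1)
      (trimonomial 3 1 0) (PowerSeries.X ^ 4) := by
  have hX : (PowerSeries.X : ℤ[X][X]⟦X⟧) ∣ PowerSeries.X ^ 4 := dvd_pow_self _ four_ne_zero
  have H := (partGF_colour_eq (w := plainWeight) (v := overWeight) (a := trimonomial 1 1 0)
    (b := trimonomial 2 0 1) (c := trimonomial 3 1 0) (Q := PowerSeries.X ^ 4) (fun k => ?_)
    (fun k => ?_) (fun k => ?_) (fun k => ?_) (fun k => ?_) (fun k => ?_) k).1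
  · rw [eq_sub_of_add_eq H.symm, sub_right_comm]
    exact (X_pow_dvd_colourF_sub_colourLim hX k).sub
      (((pow_dvd_pow_of_dvd hX k).mul_left _).mul_right _)
  all_goals
    simp only [trimonomial_mul, ← pow_mul, trimonomial_mul_X_pow]
    first | rw [plainWeight] | rw [overWeight]
    congr 1 <;> (try split_ifs) <;> omega

end Count

/-- **Theorem 1.3** (trivariate extension of Andrews' theorems): `A(n,m,ℓ) = B(n,m,ℓ)`. -/
theorem A_eq_B (n m ℓ : ℕ) : Acount n m ℓ = Bcount n m ℓ := by
  have hlt : n < n + 1 := n.lt_succ_self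
  have hA := tricoeff_congr (partGF_four_mul_sub_colourLim (n + 1)) hlt m ℓ
  rw [tricoeff_partGF (by omega), colourLim_trimonomial (n + 1)] at hA
  have hX : (PowerSeries.X : PowerSeries (Polynomial (Polynomial ℤ))) ∣ PowerSeries.X ^ 4 :=
    dvd_pow_self _ four_ne_zero
  have hone := (X_pow_dvd_colourLim_sub_one hX
    (X_pow_dvd_trimonomial (by omega : n + 1 ≤ 4 * (n + 1) + 1) 1 0)
    (X_pow_dvd_trimonomial (by omega : n + 1 ≤ 4 * (n + 1) + 2) 0 1)
    (X_pow_dvd_trimonomial (by omega : n + 1 ≤ 4 * (n + 1) + 3) 1 0)).mul_left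
    (∏ p ∈ Finset.range (4 * (n + 1)) with ¬4 ∣ p, (1 + plainWeight p))
  rw [mul_sub, mul_one] at hone
  rw [tricoeff_congr hone hlt, tricoeff_prod_one_add (by omega)] at hA
  exact_mod_cast hA
end

section
/- For nonnegative integers n, m, let A₁(n,m) be the number of overpartitions λ = (P,O) in 𝒜_{1̄}^⋁ with |λ| = n and |P| + |O| + #{p ∈ P : 4 ∣ p} = m (i.e., parts counted with overlined parts and parts divisible by 4 given weight 2). Let B₁(n,m) be the number of finite sets S of positive integers with no element divisible by 4, |S| = m, and Σ_{s∈S} s = n. Then A₁(n,m) = B₁(n,m). -/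
/-- `A₁(n,m)`: number of overpartitions `λ = (P,O) ∈ 𝒜_{1̄}^⋁` of `n` into `m` parts,
with overlined parts and parts divisible by 4 counted with weight 2. -/
noncomputable def A1count (n m : ℕ) : ℕ :=
  Set.ncard {lam : Finset ℕ × Finset ℕ | MemAVee lam.1 lam.2 ∧
    lam.1.sum id = n ∧
    lam.1.card + lam.2.card + (lam.1.filter fun p => 4 ∣ p).card = m}

/-- `B₁(n,m)`: number of partitions of `n` into `m` distinct parts none divisible by 4. -/
noncomputable def B1count (n m : ℕ) : ℕ :=
  Set.ncard {S : Finset ℕ | (∀ s ∈ S, 0 < s ∧ ¬(4 ∣ s)) ∧ S.card = m ∧ S.sum id = n}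

/-- The recurrences in the largest admissible part satisfied by the generating functions
of overpartitions in `𝒜_{1̄}^⋁` with parts bounded by `N`. -/
structure BoundedPartRec {R : Type*} [CommRing R] (x q : R) (G : ℕ → R) : Prop where
  zero : G 0 = 1
  one : G 1 = G 0 + x * q
  two : G 2 = G 1 + x * q ^ 2
  three : G 3 = G 2 + x * q ^ 3 + x ^ 2 * q ^ 3
  four : G 4 = G 3 + x ^ 2 * q ^ 4
  five : G 5 = G 4 + x * q ^ 5 * G 1 + x ^ 2 * q ^ 5 * G 1
  add_six (j : ℕ) : G (4 * j + 6) = G (4 * j + 5) + x * q ^ (4 * j + 6) * G (4 * j + 2)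
  add_seven (j : ℕ) : G (4 * j + 7) =
    G (4 * j + 6) + x * q ^ (4 * j + 7) * G (4 * j + 3) + x ^ 2 * q ^ (4 * j + 7) * G (4 * j + 2)
  add_eight (j : ℕ) : G (4 * j + 8) = G (4 * j + 7) + x ^ 2 * q ^ (4 * j + 8) * G (4 * j + 3)
  add_nine (j : ℕ) : G (4 * j + 9) =
    G (4 * j + 8) + x * q ^ (4 * j + 9) * G (4 * j + 5) + x ^ 2 * q ^ (4 * j + 9) * G (4 * j + 4)

namespace BoundedPartRec

variable {R : Type*} [CommRing R] {x q : R} {G H : ℕ → R}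

/-- A contiguity relation expressing `G N` for `4 ∣ N` through `H`, which in the application is
`G` with `x` replaced by `x q ^ 4`. -/
def Contig0 (x q : R) (G H : ℕ → R) (j : ℕ) : Prop :=
  (1 + x * q ^ 4) * G (4 * j + 12) = (1 + x * q) *
    ((1 + x * q ^ 3) * (H (4 * j + 7) + x * q ^ 4 * H (4 * j + 6))
      + x * q ^ 2 * (1 + x * q ^ 4) * H (4 * j + 6)
      + x ^ 2 * q ^ 5 * (H (4 * j + 5) + x * q ^ 4 * H (4 * j + 4)))

/-- A contiguity relation between `G` and `H` for indices congruent to 1 modulo 4. -/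
def Contig1 (x q : R) (G H : ℕ → R) (j : ℕ) : Prop :=
  (1 + x * q ^ 4) * G (4 * j + 13) = (1 + x * q) * (H (4 * j + 9) + x * q ^ 4 * H (4 * j + 8))
    + (x*q^2+x*q^3+x^2*q^3+x^2*q^4+x^2*q^5+x^2*q^7+x^3*q^6+x^3*q^8) * H (4 * j + 7)
    + (x^2*q^6+x^3*q^7+x^3*q^9+x^4*q^10) * H (4 * j + 6)

/-- A contiguity relation between `G` and `H` for indices congruent to 2 modulo 4. -/
def Contig2 (x q : R) (G H : ℕ → R) (j : ℕ) : Prop :=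
  (1 + x * q ^ 4) * (q ^ (4 * j + 12) * G (4 * j + 14)) =
    (x^2*q^5+x^3*q^8) * (H (4 * j + 10) - H (4 * j + 9))
    + q ^ (4 * j + 12) * ((1 + x * q ^ 4) * H (4 * j + 10) + (x*q+x*q^2+x*q^3) * H (4 * j + 9)
      + (x^2*q^5+x^2*q^6+x^2*q^7) * H (4 * j + 8)
      + (x^2*q^3+x^2*q^4+x^2*q^5+x^3*q^6+x^3*q^8+x^3*q^9) * H (4 * j + 7))

/-- A contiguity relation between `G` and `H` for indices congruent to 3 modulo 4. -/
def Contig3 (x q : R) (G H : ℕ → R) (j : ℕ) : Prop :=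
  (1 + x * q ^ 4) * (q ^ (4 * j + 8) * G (4 * j + 11)) =
    (x^2*q^3+x^3*q^7) * (H (4 * j + 7) - H (4 * j + 6))
    - (x^3*q^8+x^4*q^12) * (H (4 * j + 6) - H (4 * j + 5))
    + q ^ (4 * j + 8) * ((1 + x * q ^ 3) * H (4 * j + 7)
      + (x*q+x*q^2+x*q^4+x^2*q^5+x^2*q^6+x^2*q^7) * H (4 * j + 6)
      + (x^2*q^3+x^2*q^4+x^2*q^5) * H (4 * j + 5)
      + (x^3*q^7+x^3*q^8+x^3*q^9) * H (4 * j + 4))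

theorem contig0_succ [IsDomain R] (hq : q ≠ 0) (hG : BoundedPartRec x q G)
    (hH : BoundedPartRec (x * q ^ 4) q H) {j : ℕ} (h : Contig3 x q G H j)
    (h' : Contig3 x q G H (j + 1)) : Contig0 x q G H (j + 1) := by
  unfold Contig3 at h h'
  unfold Contig0
  have e1 := hG.add_eight (j + 2)
  have g1 := hH.add_six j
  have g2 := hH.add_seven j
  have g3 := hH.add_eight j
  have f1 := hH.add_nine j
  have f2 := hH.add_six (j + 1)
  have f3 := hH.add_seven (j + 1)
  simp only [Nat.mul_add, Nat.reduceMul, Nat.reduceAdd, Nat.add_assoc, Nat.mul_one] at *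
  rw [e1]
  simp only [f3, f2, f1, g3, g2, g1] at h h' ⊢
  refine mul_left_cancel₀ (pow_ne_zero (4 * j + 12) hq) ?_
  linear_combination h' + x ^ 2 * q ^ (4 * j + 20) * h

theorem contig1_succ (hG : BoundedPartRec x q G)
    (hH : BoundedPartRec (x * q ^ 4) q H) {j : ℕ} (h0 : Contig0 x q G H j)
    (h1 : Contig1 x q G H j) (h0' : Contig0 x q G H (j + 1)) : Contig1 x q G H (j + 1) := by
  unfold Contig0 at h0 h0'
  unfold Contig1 at *
  have e1 := hG.add_nine (j + 2)
  have f1 := hH.add_nine j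
  have f2 := hH.add_six (j + 1)
  have f3 := hH.add_seven (j + 1)
  have f4 := hH.add_eight (j + 1)
  have f5 := hH.add_nine (j + 1)
  simp only [Nat.mul_add, Nat.reduceMul, Nat.reduceAdd, Nat.add_assoc, Nat.mul_one] at *
  rw [e1]
  simp only [f5, f4, f3, f2, f1] at h0 h1 h0' ⊢
  linear_combination h0' + x * q ^ (4 * j + 17) * h1 + x ^ 2 * q ^ (4 * j + 17) * h0

theorem contig2_succ (hG : BoundedPartRec x q G)
    (hH : BoundedPartRec (x * q ^ 4) q H) {j : ℕ} (h2 : Contig2 x q G H j)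
    (h1 : Contig1 x q G H (j + 1)) : Contig2 x q G H (j + 1) := by
  unfold Contig2 at *
  unfold Contig1 at *
  have e1 := hG.add_six (j + 3)
  have f1 := hH.add_nine j
  have f2 := hH.add_six (j + 1)
  have f3 := hH.add_seven (j + 1)
  have f4 := hH.add_eight (j + 1)
  have f5 := hH.add_nine (j + 1)
  have f6 := hH.add_six (j + 2)
  simp only [Nat.mul_add, Nat.reduceMul, Nat.reduceAdd, Nat.add_assoc, Nat.mul_one] at *
  rw [e1]
  simp only [f6, f5, f4, f3, f2, f1] at h1 h2 ⊢
  linear_combination q ^ (4 * j + 16) * h1 + x * q ^ (4 * j + 22) * h2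

theorem contig3_succ (hG : BoundedPartRec x q G)
    (hH : BoundedPartRec (x * q ^ 4) q H) {j : ℕ} (h2 : Contig2 x q G H j)
    (h3 : Contig3 x q G H (j + 1))
    (h2' : Contig2 x q G H (j + 1)) : Contig3 x q G H (j + 2) := by
  unfold Contig2 at *
  unfold Contig3 at *
  have e1 := hG.add_seven (j + 3)
  have f1 := hH.add_nine j
  have f2 := hH.add_six (j + 1)
  have f3 := hH.add_seven (j + 1)
  have f4 := hH.add_eight (j + 1)
  have f5 := hH.add_nine (j + 1)
  have f6 := hH.add_six (j + 2)
  have f7 := hH.add_seven (j + 2)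
  simp only [Nat.mul_add, Nat.reduceMul, Nat.reduceAdd, Nat.add_assoc, Nat.mul_one] at *
  rw [e1]
  simp only [f7, f6, f5, f4, f3, f2, f1] at h2 h3 h2' ⊢
  linear_combination h2' + x * q ^ (4 * j + 23) * h3 + x ^ 2 * q ^ (4 * j + 23) * h2

theorem contig_base (hG : BoundedPartRec x q G) (hH : BoundedPartRec (x * q ^ 4) q H) :
    Contig0 x q G H 0 ∧ Contig1 x q G H 0 ∧ Contig2 x q G H 0 ∧ Contig3 x q G H 0 ∧
      Contig3 x q G H 1 := by
  have unroll {y : R} {F : ℕ → R} (hF : BoundedPartRec y q F) :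
      F 6 = F 5 + y * q ^ 6 * F 2 ∧
      F 7 = F 6 + y * q ^ 7 * F 3 + y ^ 2 * q ^ 7 * F 2 ∧
      F 8 = F 7 + y ^ 2 * q ^ 8 * F 3 ∧
      F 9 = F 8 + y * q ^ 9 * F 5 + y ^ 2 * q ^ 9 * F 4 ∧
      F 10 = F 9 + y * q ^ 10 * F 6 ∧
      F 11 = F 10 + y * q ^ 11 * F 7 + y ^ 2 * q ^ 11 * F 6 ∧
      F 12 = F 11 + y ^ 2 * q ^ 12 * F 7 ∧
      F 13 = F 12 + y * q ^ 13 * F 9 + y ^ 2 * q ^ 13 * F 8 ∧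
      F 14 = F 13 + y * q ^ 14 * F 10 ∧
      F 15 = F 14 + y * q ^ 15 * F 11 + y ^ 2 * q ^ 15 * F 10 :=
    ⟨hF.add_six 0, hF.add_seven 0, hF.add_eight 0, hF.add_nine 0, hF.add_six 1, hF.add_seven 1,
      hF.add_eight 1, hF.add_nine 1, hF.add_six 2, hF.add_seven 2⟩
  obtain ⟨g6, g7, g8, g9, g10, g11, g12, g13, g14, g15⟩ := unroll hG
  obtain ⟨h6, h7, h8, h9, h10, h11, -⟩ := unroll hH
  unfold Contig0 Contig1 Contig2 Contig3
  simp only [Nat.mul_zero, Nat.mul_one, Nat.zero_add, Nat.reduceAdd,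
    g15, g14, g13, g12, g11, g10, g9, g8, g7, g6, hG.five, hG.four, hG.three, hG.two, hG.one,
    hG.zero, h11, h10, h9, h8, h7, h6, hH.five, hH.four, hH.three, hH.two, hH.one, hH.zero]
  refine ⟨?_, ?_, ?_, ?_, ?_⟩ <;> ring

theorem contig0 [IsDomain R] (hq : q ≠ 0) (hG : BoundedPartRec x q G)
    (hH : BoundedPartRec (x * q ^ 4) q H) (j : ℕ) : Contig0 x q G H j := by
  suffices h : Contig0 x q G H j ∧ Contig1 x q G H j ∧ Contig2 x q G H j ∧ Contig3 x q G H j ∧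
      Contig3 x q G H (j + 1) from h.1
  induction j with
  | zero => exact contig_base hG hH
  | succ j ih =>
    obtain ⟨h0, h1, h2, h3, h3'⟩ := ih
    have h0' := contig0_succ hq hG hH h3 h3'
    have h1' := contig1_succ hG hH h0 h1 h0'
    have h2' := contig2_succ hG hH h2 h1'
    exact ⟨h0', h1', h2', h3', contig3_succ hG hH h2 h3' h2'⟩

theorem modEq_four_mul (hG : BoundedPartRec x q G) (k : ℕ) :
    x * q ^ (4 * k) ∣ G (4 * k + 1) - G (4 * k) ∧ x * q ^ (4 * k) ∣ G (4 * k + 2) - G (4 * k) ∧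
      x * q ^ (4 * k) ∣ G (4 * k + 3) - G (4 * k) ∧
      x * q ^ (4 * k) ∣ G (4 * k + 4) - G (4 * k) := by
  rcases k with _ | _ | k
  · simp only [Nat.mul_zero, Nat.zero_add, hG.four, hG.three, hG.two, hG.one, pow_zero, mul_one]
    refine ⟨⟨q, ?_⟩, ⟨q + q ^ 2, ?_⟩, ⟨q + q ^ 2 + q ^ 3 + x * q ^ 3, ?_⟩,
      ⟨q + q ^ 2 + q ^ 3 + x * q ^ 3 + x * q ^ 4, ?_⟩⟩ <;> ring
  · have g6 : G 6 = _ := hG.add_six 0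
    have g7 : G 7 = _ := hG.add_seven 0
    have g8 : G 8 = _ := hG.add_eight 0
    simp only [Nat.mul_zero, Nat.zero_add, Nat.mul_one, Nat.reduceAdd] at g6 g7 g8 ⊢
    rw [g8, g7, g6, hG.five]
    refine ⟨⟨q * G 1 + x * q * G 1, ?_⟩, ⟨q * G 1 + x * q * G 1 + q ^ 2 * G 2, ?_⟩,
      ⟨q * G 1 + x * q * G 1 + q ^ 2 * G 2 + q ^ 3 * G 3 + x * q ^ 3 * G 2, ?_⟩,
      ⟨q * G 1 + x * q * G 1 + q ^ 2 * G 2 + q ^ 3 * G 3 + x * q ^ 3 * G 2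
        + x * q ^ 4 * G 3, ?_⟩⟩ <;> ring
  · have g1 := hG.add_nine k
    have g2 := hG.add_six (k + 1)
    have g3 := hG.add_seven (k + 1)
    have g4 := hG.add_eight (k + 1)
    simp only [Nat.mul_add, Nat.add_assoc, Nat.reduceMul, Nat.reduceAdd] at g1 g2 g3 g4 ⊢
    rw [g4, g3, g2, g1]
    refine ⟨⟨q * G (4 * k + 5) + x * q * G (4 * k + 4), ?_⟩,
      ⟨q * G (4 * k + 5) + x * q * G (4 * k + 4) + q ^ 2 * G (4 * k + 6), ?_⟩,
      ⟨q * G (4 * k + 5) + x * q * G (4 * k + 4) + q ^ 2 * G (4 * k + 6)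
        + q ^ 3 * G (4 * k + 7) + x * q ^ 3 * G (4 * k + 6), ?_⟩,
      ⟨q * G (4 * k + 5) + x * q * G (4 * k + 4) + q ^ 2 * G (4 * k + 6)
        + q ^ 3 * G (4 * k + 7) + x * q ^ 3 * G (4 * k + 6) + x * q ^ 4 * G (4 * k + 7), ?_⟩⟩ <;>
    ring

/-- Up to a high power of `q`, the bounded generating function satisfies
`G(x) ≡ (1 + x q)(1 + x q²)(1 + x q³) G(x q⁴)`. -/
theorem pow_dvd_sub [IsDomain R] (hq : q ≠ 0) (hG : BoundedPartRec x q G)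
    (hH : BoundedPartRec (x * q ^ 4) q H) {s : ℕ} (hs : q ^ s ∣ x) (j : ℕ) :
    q ^ (s + 4 * j + 8) ∣
      G (4 * j + 12) - (1 + x * q) * (1 + x * q ^ 2) * (1 + x * q ^ 3) * H (4 * j + 8) := by
  have h := contig0 hq hG hH j
  unfold Contig0 at h
  obtain ⟨⟨a, ha⟩, ⟨b, hb⟩, ⟨c, hc⟩, ⟨d, hd⟩⟩ := hH.modEq_four_mul (j + 1)
  simp only [Nat.mul_add, Nat.add_assoc, Nat.reduceMul, Nat.reduceAdd] at ha hb hc hd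
  obtain ⟨y, hy⟩ := hs
  have hcop : IsCoprime (q ^ (s + 4 * j + 8)) (1 + x * q ^ 4) :=
    IsCoprime.pow_left ⟨-(x * q ^ 3), 1, by ring⟩
  refine hcop.dvd_of_dvd_mul_left
    ⟨y * ((1 + x * q) * ((1 + x * q ^ 3) * (c + x * q ^ 4 * b)
      + x * q ^ 2 * (1 + x * q ^ 4) * b + x ^ 2 * q ^ 5 * a)
      - (1 + x * q ^ 4) * ((1 + x * q) * (1 + x * q ^ 2) * (1 + x * q ^ 3)) * d), ?_⟩
  linear_combination h + (1 + x * q) * ((1 + x * q ^ 3) * (hc + x * q ^ 4 * hb)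
    + x * q ^ 2 * (1 + x * q ^ 4) * hb + x ^ 2 * q ^ 5 * ha)
    - (1 + x * q ^ 4) * ((1 + x * q) * (1 + x * q ^ 2) * (1 + x * q ^ 3)) * hd
    + q ^ (4 * j + 8) * ((1 + x * q) * ((1 + x * q ^ 3) * (c + x * q ^ 4 * b)
      + x * q ^ 2 * (1 + x * q ^ 4) * b + x ^ 2 * q ^ 5 * a)
      - (1 + x * q ^ 4) * ((1 + x * q) * (1 + x * q ^ 2) * (1 + x * q ^ 3)) * d) * hy

/-- Up to a high power of `q`, the bounded generating function agrees with the product of the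
factors `1 + x q ^ p` over `p` not divisible by four. -/
theorem pow_dvd_sub_prod [IsDomain R] (hq : q ≠ 0) {F : R → ℕ → R}
    (hF : ∀ x, BoundedPartRec x q (F x)) (k : ℕ) :
    ∀ (s : ℕ) (x : R), q ^ s ∣ x → q ^ (s + 4 * k) ∣ F x (4 * k + 8) -
      ∏ i ∈ Finset.range (k + 2), (1 + x * q ^ (4 * i) * q) * (1 + x * q ^ (4 * i) * q ^ 2) *
        (1 + x * q ^ (4 * i) * q ^ 3) := by
  induction k with
  | zero =>
    intro s x hs
    refine hs.trans ?_
    have hmul {a b : R} (ha : x ∣ a - 1) (hb : x ∣ b - 1) : x ∣ a * b - 1 := by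
      convert (ha.mul_right b).add hb using 1
      ring
    have hfac (a b : R) : x ∣ 1 + x * a * b - 1 := ⟨a * b, by ring⟩
    have hprod := Finset.prod_induction (s := Finset.range (0 + 2))
      (fun i => (1 + x * q ^ (4 * i) * q) * (1 + x * q ^ (4 * i) * q ^ 2) *
        (1 + x * q ^ (4 * i) * q ^ 3)) (fun a => x ∣ a - 1) (fun _ _ => hmul) (by simp)
      (fun i _ => hmul (hmul (hfac _ _) (hfac _ _)) (hfac _ _))
    have h4 := (dvd_mul_right _ _).trans ((hF x).modEq_four_mul 0).2.2.2
    have h8 := (dvd_mul_right _ _).trans ((hF x).modEq_four_mul 1).2.2.2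
    rw [(hF x).zero] at h4
    convert (h8.add h4).sub hprod using 1
    simp
  | succ k ih =>
    rintro s x hs
    have h := (hF x).pow_dvd_sub hq (hF (x * q ^ 4)) hs k
    have h' := ih (s + 4) (x * q ^ 4) (by rw [pow_add]; exact mul_dvd_mul_right hs _)
    rw [Finset.prod_range_succ']
    have e (i : ℕ) : x * q ^ (4 * (i + 1)) = x * q ^ 4 * q ^ (4 * i) := by ring
    simp only [e, Nat.mul_zero, pow_zero, mul_one]
    have h1 := ((pow_dvd_pow q (by lia : s + 4 * (k + 1) ≤ s + 4 * k + 8)).trans h)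
    have h2 := ((pow_dvd_pow q (by lia : s + 4 * (k + 1) ≤ s + 4 + 4 * k)).trans h')
    convert h1.add (h2.mul_left ((1 + x * q) * (1 + x * q ^ 2) * (1 + x * q ^ 3))) using 1
    · rw [show 4 * (k + 1) + 8 = 4 * k + 12 by ring]
      ring

end BoundedPartRec

/-- The number of parts, overlined parts and parts divisible by four counted twice. -/
def aVeeWeight (l : Finset ℕ × Finset ℕ) : ℕ :=
  l.1.card + l.2.card + (l.1.filter fun p => 4 ∣ p).card

open Classical in
/-- The overpartitions in `𝒜_{1̄}^⋁` with parts at most `N`. -/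
noncomputable def aVee (N : ℕ) : Finset (Finset ℕ × Finset ℕ) :=
  ((Finset.Icc 1 N).powerset ×ˢ (Finset.Icc 1 N).powerset).filter fun l => MemAVee l.1 l.2

theorem mem_aVee {N : ℕ} {l : Finset ℕ × Finset ℕ} :
    l ∈ aVee N ↔ MemAVee l.1 l.2 ∧ ∀ p ∈ l.1, p ≤ N := by
  simp only [aVee, Finset.mem_filter, Finset.mem_product, Finset.mem_powerset]
  constructor
  · rintro ⟨⟨h1, -⟩, h⟩
    exact ⟨h, fun p hp => (Finset.mem_Icc.1 (h1 hp)).2⟩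
  · rintro ⟨h, hN⟩
    have hsub : l.1 ⊆ Finset.Icc 1 N := fun p hp => Finset.mem_Icc.2 ⟨h.1 p hp, hN p hp⟩
    exact ⟨⟨hsub, h.2.1.trans hsub⟩, h⟩

/-- The generating function of the overpartitions in `𝒜_{1̄}^⋁` with parts at most `N`. -/
noncomputable def aVeeGen {R : Type*} [CommRing R] (q x : R) (N : ℕ) : R :=
  ∑ l ∈ aVee N, x ^ aVeeWeight l * q ^ l.1.sum id

theorem mem_aVee_insert {p M : ℕ} (hp : 0 < p) (hMp : M < p)
    (hM : ∀ b, 0 < b → b < p → (b ≤ M ↔ 4 ≤ p - b ∧ (4 ∣ p → 5 ≤ p - b)))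
    {P O : Finset ℕ} (hPO : ∀ b ∈ P, b < p) (hO : p ∉ O) :
    (insert p P, O) ∈ aVee p ↔ (P, O) ∈ aVee M := by
  rw [mem_aVee, mem_aVee]
  constructor
  · rintro ⟨⟨h1, h2, h3, h4⟩, -⟩
    refine ⟨⟨fun b hb => h1 b (Finset.mem_insert_of_mem hb), fun b hb => ?_, h3, fun a ha b hb =>
      h4 a (Finset.mem_insert_of_mem ha) b (Finset.mem_insert_of_mem hb)⟩, fun b hb => ?_⟩
    · exact (Finset.mem_insert.1 (h2 hb)).resolve_left (ne_of_mem_of_not_mem hb hO)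
    · have h := h4 p (Finset.mem_insert_self _ _) b (Finset.mem_insert_of_mem hb) (hPO b hb)
        (fun h => hO h.2.1)
      exact (hM b (h1 b (Finset.mem_insert_of_mem hb)) (hPO b hb)).2
        ⟨h.1, fun h' => h.2 (Or.inr h')⟩
  · rintro ⟨⟨h1, h2, h3, h4⟩, hle⟩
    refine ⟨⟨fun b hb => ?_, h2.trans (Finset.subset_insert _ _), h3, fun a ha b hb hab => ?_⟩,
      fun b hb => ?_⟩
    · rcases Finset.mem_insert.1 hb with rfl | hb
      exacts [hp, h1 b hb]
    · rcases Finset.mem_insert.1 ha with rfl | ha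
      · have hb := Finset.mem_of_mem_insert_of_ne hb hab.ne
        have h := (hM b (h1 b hb) hab).1 (hle b hb)
        exact fun _ => ⟨h.1, fun h' => h.2 (h'.resolve_left hO)⟩
      · have hb := Finset.mem_of_mem_insert_of_ne hb (hab.trans (hPO a ha)).ne
        exact h4 a ha b hb hab
    · rcases Finset.mem_insert.1 hb with rfl | hb
      exacts [le_rfl, (hPO b hb).le]

theorem mem_aVee_insert_insert {p M : ℕ} (hp : Odd p) (hp1 : 1 < p) (hMp : M < p)
    (hM : ∀ b, 0 < b → b < p → (b ≤ M ↔ p = 5 ∧ b = 1 ∨ 5 ≤ p - b))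
    {P O : Finset ℕ} (hPO : ∀ b ∈ P, b < p) (hO : p ∉ O) :
    (insert p P, insert p O) ∈ aVee p ↔ (P, O) ∈ aVee M := by
  rw [mem_aVee, mem_aVee]
  constructor
  · rintro ⟨⟨h1, h2, h3, h4⟩, -⟩
    refine ⟨⟨fun b hb => h1 b (Finset.mem_insert_of_mem hb), fun b hb => ?_,
      fun b hb => h3 b (Finset.mem_insert_of_mem hb), fun a ha b hb hab hex => ?_⟩, fun b hb => ?_⟩
    · exact (Finset.mem_insert.1 (h2 (Finset.mem_insert_of_mem hb))).resolve_left
        (ne_of_mem_of_not_mem hb hO)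
    · have h := h4 a (Finset.mem_insert_of_mem ha) b (Finset.mem_insert_of_mem hb) hab fun h =>
        hex ⟨h.1, Finset.mem_of_mem_insert_of_ne h.2.1 (hPO a ha).ne, h.2.2⟩
      exact ⟨h.1, fun h' => h.2 (h'.imp_left fun h => Finset.mem_insert_of_mem h)⟩
    · refine (hM b (h1 b (Finset.mem_insert_of_mem hb)) (hPO b hb)).2 ?_
      have h := h4 p (Finset.mem_insert_self _ _) b (Finset.mem_insert_of_mem hb) (hPO b hb)
      by_cases hex : p = 5 ∧ b = 1
      · exact Or.inl hex
      · exact Or.inr ((h fun h => hex ⟨h.1, h.2.2⟩).2 (Or.inl (Finset.mem_insert_self _ _)))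
  · rintro ⟨⟨h1, h2, h3, h4⟩, hle⟩
    refine ⟨⟨fun b hb => ?_, Finset.insert_subset_insert _ h2, fun b hb => ?_,
      fun a ha b hb hab hex => ?_⟩, fun b hb => ?_⟩
    · rcases Finset.mem_insert.1 hb with rfl | hb
      exacts [hMp.pos, h1 b hb]
    · rcases Finset.mem_insert.1 hb with rfl | hb
      exacts [⟨hp, hp1⟩, h3 b hb]
    · rcases Finset.mem_insert.1 ha with rfl | ha
      · have hb := Finset.mem_of_mem_insert_of_ne hb hab.ne
        have h := ((hM b (h1 b hb) hab).1 (hle b hb)).resolve_left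
          fun h => hex ⟨h.1, Finset.mem_insert_self _ _, h.2⟩
        exact ⟨by lia, fun _ => h⟩
      · have hb := Finset.mem_of_mem_insert_of_ne hb (hab.trans (hPO a ha)).ne
        have h := h4 a ha b hb hab fun h => hex ⟨h.1, Finset.mem_insert_of_mem h.2.1, h.2.2⟩
        exact ⟨h.1, fun h' => h.2 (h'.imp_left fun h =>
          Finset.mem_of_mem_insert_of_ne h (hPO a ha).ne)⟩
    · rcases Finset.mem_insert.1 hb with rfl | hb
      exacts [le_rfl, (hPO b hb).le]

variable {R : Type*} [CommRing R] (q x : R)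

theorem sum_aVee_not_overlined {p M : ℕ} (hp : 0 < p) (hMp : M < p)
    (hM : ∀ b, 0 < b → b < p → (b ≤ M ↔ 4 ≤ p - b ∧ (4 ∣ p → 5 ≤ p - b))) :
    ∑ l ∈ aVee p with p ∈ l.1 ∧ p ∉ l.2, x ^ aVeeWeight l * q ^ l.1.sum id =
      x ^ (if 4 ∣ p then 2 else 1) * q ^ p * aVeeGen q x M := by
  rw [aVeeGen, Finset.mul_sum]
  have hlt {l : Finset ℕ × Finset ℕ} (hl : l ∈ aVee M) : p ∉ l.1 ∧ p ∉ l.2 := by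
    have h := mem_aVee.1 hl
    have h1 : p ∉ l.1 := fun h' => hMp.not_ge (h.2 p h')
    exact ⟨h1, fun h' => h1 (h.1.2.1 h')⟩
  refine Finset.sum_nbij' (fun l => (l.1.erase p, l.2)) (fun l => (insert p l.1, l.2))
    ?_ ?_ ?_ ?_ ?_
  · rintro ⟨P, O⟩ h
    obtain ⟨h, hP, hO⟩ := Finset.mem_filter.1 h
    refine (mem_aVee_insert hp hMp hM (fun b hb => ?_) hO).1 (by rwa [Finset.insert_erase hP])
    exact ((mem_aVee.1 h).2 b (Finset.mem_of_mem_erase hb)).lt_of_ne (Finset.ne_of_mem_erase hb)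
  · rintro ⟨P, O⟩ h
    exact Finset.mem_filter.2 ⟨(mem_aVee_insert hp hMp hM
      (fun b hb => ((mem_aVee.1 h).2 b hb).trans_lt hMp) (hlt h).2).2 h,
      Finset.mem_insert_self _ _, (hlt h).2⟩
  · rintro ⟨P, O⟩ h
    simp [Finset.insert_erase (Finset.mem_filter.1 h).2.1]
  · rintro ⟨P, O⟩ h
    simp [Finset.erase_insert (hlt h).1]
  · rintro ⟨P, O⟩ h
    obtain ⟨h, hP, hO⟩ := Finset.mem_filter.1 h
    obtain ⟨P, hPp, rfl⟩ : ∃ P', p ∉ P' ∧ P = insert p P' :=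
      ⟨P.erase p, by simp, (Finset.insert_erase hP).symm⟩
    simp only [aVeeWeight, Finset.erase_insert hPp, Finset.sum_insert hPp, Finset.filter_insert,
      Finset.card_insert_of_notMem hPp, id]
    split_ifs
    · rw [Finset.card_insert_of_notMem (by simp [hPp])]
      ring
    · ring

theorem sum_aVee_overlined {p M : ℕ} (hp : Odd p) (hp1 : 1 < p) (hMp : M < p)
    (hM : ∀ b, 0 < b → b < p → (b ≤ M ↔ p = 5 ∧ b = 1 ∨ 5 ≤ p - b)) :
    ∑ l ∈ aVee p with p ∈ l.2, x ^ aVeeWeight l * q ^ l.1.sum id =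
      x ^ 2 * q ^ p * aVeeGen q x M := by
  rw [aVeeGen, Finset.mul_sum]
  have hlt {l : Finset ℕ × Finset ℕ} (hl : l ∈ aVee M) : p ∉ l.1 ∧ p ∉ l.2 := by
    have h := mem_aVee.1 hl
    have h1 : p ∉ l.1 := fun h' => hMp.not_ge (h.2 p h')
    exact ⟨h1, fun h' => h1 (h.1.2.1 h')⟩
  have h4 : ¬ 4 ∣ p := by
    obtain ⟨k, rfl⟩ := hp
    lia
  refine Finset.sum_nbij' (fun l => (l.1.erase p, l.2.erase p))
    (fun l => (insert p l.1, insert p l.2)) ?_ ?_ ?_ ?_ ?_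
  · rintro ⟨P, O⟩ h
    obtain ⟨h, hO⟩ := Finset.mem_filter.1 h
    have hP := (mem_aVee.1 h).1.2.1 hO
    refine (mem_aVee_insert_insert hp hp1 hMp hM (fun b hb => ?_) (Finset.notMem_erase _ _)).1
      (by rwa [Finset.insert_erase hP, Finset.insert_erase hO])
    exact ((mem_aVee.1 h).2 b (Finset.mem_of_mem_erase hb)).lt_of_ne (Finset.ne_of_mem_erase hb)
  · rintro ⟨P, O⟩ h
    exact Finset.mem_filter.2 ⟨(mem_aVee_insert_insert hp hp1 hMp hM
      (fun b hb => ((mem_aVee.1 h).2 b hb).trans_lt hMp) (hlt h).2).2 h,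
      Finset.mem_insert_self _ _⟩
  · rintro ⟨P, O⟩ h
    obtain ⟨h, hO⟩ := Finset.mem_filter.1 h
    have hP := (mem_aVee.1 h).1.2.1 hO
    simp only [Finset.insert_erase hP, Finset.insert_erase hO]
  · rintro ⟨P, O⟩ h
    simp only [Finset.erase_insert (hlt h).1, Finset.erase_insert (hlt h).2]
  · rintro ⟨P, O⟩ h
    obtain ⟨h, hO⟩ := Finset.mem_filter.1 h
    have hP := (mem_aVee.1 h).1.2.1 hO
    obtain ⟨P, hPp, rfl⟩ : ∃ P', p ∉ P' ∧ P = insert p P' :=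
      ⟨P.erase p, by simp, (Finset.insert_erase hP).symm⟩
    obtain ⟨O, hOp, rfl⟩ : ∃ O', p ∉ O' ∧ O = insert p O' :=
      ⟨O.erase p, by simp, (Finset.insert_erase hO).symm⟩
    simp only [aVeeWeight, Finset.erase_insert hPp, Finset.erase_insert hOp,
      Finset.sum_insert hPp, Finset.filter_insert, if_neg h4,
      Finset.card_insert_of_notMem hPp, Finset.card_insert_of_notMem hOp, id]
    ring

theorem aVeeGen_eq_add (p : ℕ) : aVeeGen q x (p + 1) = aVeeGen q x p +
    ∑ l ∈ aVee (p + 1) with p + 1 ∈ l.1 ∧ p + 1 ∉ l.2, x ^ aVeeWeight l * q ^ l.1.sum id +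
    ∑ l ∈ aVee (p + 1) with p + 1 ∈ l.2, x ^ aVeeWeight l * q ^ l.1.sum id := by
  have h : aVee p = (aVee (p + 1)).filter fun l => p + 1 ∉ l.1 := by
    ext l
    simp only [Finset.mem_filter, mem_aVee]
    grind
  have h1 : (aVee (p + 1)).filter (fun l => p + 1 ∈ l.2) =
      ((aVee (p + 1)).filter fun l => p + 1 ∈ l.1).filter fun l => p + 1 ∈ l.2 := by
    ext l
    simp only [Finset.mem_filter, mem_aVee]
    have : MemAVee l.1 l.2 → p + 1 ∈ l.2 → p + 1 ∈ l.1 := fun h h' => h.2.1 h'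
    tauto
  rw [aVeeGen, aVeeGen, h, h1, ← Finset.filter_filter,
    ← Finset.sum_filter_not_add_sum_filter _ (fun l => p + 1 ∈ l.1),
    ← Finset.sum_filter_not_add_sum_filter ((aVee (p + 1)).filter fun l => p + 1 ∈ l.1)
      (fun l => p + 1 ∈ l.2), add_assoc]

theorem aVeeGen_of_not_overlinable {p M : ℕ} (hp : ¬ (Odd (p + 1) ∧ 1 < p + 1)) (hMp : M ≤ p)
    (hM : ∀ b, 0 < b → b < p + 1 →
      (b ≤ M ↔ 4 ≤ p + 1 - b ∧ (4 ∣ p + 1 → 5 ≤ p + 1 - b))) :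
    aVeeGen q x (p + 1) = aVeeGen q x p +
      x ^ (if 4 ∣ p + 1 then 2 else 1) * q ^ (p + 1) * aVeeGen q x M := by
  have h : ∑ l ∈ aVee (p + 1) with p + 1 ∈ l.2, x ^ aVeeWeight l * q ^ l.1.sum id = 0 := by
    refine Finset.sum_eq_zero fun l hl => ?_
    obtain ⟨hl, hp'⟩ := Finset.mem_filter.1 hl
    exact absurd ((mem_aVee.1 hl).1.2.2.1 _ hp') hp
  rw [aVeeGen_eq_add, sum_aVee_not_overlined q x p.succ_pos (Nat.lt_succ_of_le hMp) hM, h,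
    add_zero]

theorem aVeeGen_of_overlinable {p M M' : ℕ} (hp : Odd (p + 1)) (hp1 : 1 < p + 1) (hMp : M ≤ p)
    (hMp' : M' ≤ p) (hM : ∀ b, 0 < b → b < p + 1 → (b ≤ M ↔ 4 ≤ p + 1 - b))
    (hM' : ∀ b, 0 < b → b < p + 1 → (b ≤ M' ↔ p + 1 = 5 ∧ b = 1 ∨ 5 ≤ p + 1 - b)) :
    aVeeGen q x (p + 1) = aVeeGen q x p + x * q ^ (p + 1) * aVeeGen q x M +
      x ^ 2 * q ^ (p + 1) * aVeeGen q x M' := by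
  have h4 : ¬ 4 ∣ p + 1 := by
    obtain ⟨k, hk⟩ := hp
    lia
  rw [aVeeGen_eq_add, sum_aVee_overlined q x hp hp1 (Nat.lt_succ_of_le hMp') hM',
    sum_aVee_not_overlined q x p.succ_pos (Nat.lt_succ_of_le hMp) (by simpa [h4] using hM),
    if_neg h4, pow_one]

theorem aVeeGen_zero : aVeeGen q x 0 = 1 := by
  have : aVee 0 = {(∅, ∅)} := by
    ext ⟨P, O⟩
    simp [aVee, MemAVee]
    grind
  simp [aVeeGen, this, aVeeWeight]

theorem boundedPartRec_aVeeGen : BoundedPartRec x q (aVeeGen q x) where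
  zero := aVeeGen_zero q x
  one := by
    rw [aVeeGen_of_not_overlinable (p := 0) (M := 0) q x
      (by decide) (by lia) (by lia), aVeeGen_zero]
    simp
  two := by
    rw [aVeeGen_of_not_overlinable (p := 1) (M := 0) q x
      (by decide) (by lia) (by lia), aVeeGen_zero]
    simp
  three := by
    rw [aVeeGen_of_overlinable (p := 2) (M := 0) (M' := 0) q x
      (by decide) (by lia) (by lia) (by lia)
      (by lia) (by lia), aVeeGen_zero]
    ring
  four := by
    rw [aVeeGen_of_not_overlinable (p := 3) (M := 0) q x
      (by decide) (by lia) (by lia), aVeeGen_zero]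
    simp
  five := by
    rw [aVeeGen_of_overlinable (p := 4) (M := 1) (M' := 1) q x
      (by decide) (by lia) (by lia) (by lia)
      (by lia) (by lia)]
  add_six j := by
    rw [aVeeGen_of_not_overlinable (p := 4 * j + 5) (M := 4 * j + 2) q x
      (by grind) (by lia) (by lia),
      if_neg (by lia), pow_one]
  add_seven j := by
    rw [aVeeGen_of_overlinable (p := 4 * j + 6) (M := 4 * j + 3) (M' := 4 * j + 2) q x
      (by grind)
      (by lia) (by lia) (by lia) (by lia) (by lia)]
  add_eight j := by
    rw [aVeeGen_of_not_overlinable (p := 4 * j + 7) (M := 4 * j + 3) q x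
      (by grind) (by lia) (by lia),
      if_pos (by lia)]
  add_nine j := by
    rw [aVeeGen_of_overlinable (p := 4 * j + 8) (M := 4 * j + 5) (M' := 4 * j + 4) q x
      (by grind)
      (by lia) (by lia) (by lia) (by lia) (by lia)]

theorem prod_range_eq_sum_powerset (K : ℕ) :
    ∏ i ∈ Finset.range K, (1 + x * q ^ (4 * i) * q) * (1 + x * q ^ (4 * i) * q ^ 2) *
        (1 + x * q ^ (4 * i) * q ^ 3) =
      ∑ t ∈ ((Finset.range (4 * K)).filter fun p => ¬ 4 ∣ p).powerset,
        x ^ t.card * q ^ t.sum id := by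
  have h (t : Finset ℕ) : x ^ t.card * q ^ t.sum id = ∏ p ∈ t, x * q ^ p := by
    rw [Finset.prod_mul_distrib, Finset.prod_const, Finset.prod_pow_eq_pow_sum]
    rfl
  simp only [h]
  rw [← Finset.prod_one_add, Finset.prod_filter]
  induction K with
  | zero => simp
  | succ K ih =>
    rw [Finset.prod_range_succ, ih, Nat.mul_succ, Finset.prod_range_succ, Finset.prod_range_succ,
      Finset.prod_range_succ, Finset.prod_range_succ, if_neg (by simp), if_pos (by lia),
      if_pos (by lia), if_pos (by lia)]
    ring

open Polynomial in
theorem coeff_coeff_sum {ι : Type*} (S : Finset ι) (w d : ι → ℕ) (n m : ℕ) :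
    ((∑ l ∈ S, (C X : ℤ[X][X]) ^ w l * X ^ d l).coeff n).coeff m =
      ((S.filter fun l => d l = n ∧ w l = m).card : ℤ) := by
  rw [finsetSum_coeff, finsetSum_coeff, Finset.card_filter, Nat.cast_sum]
  refine Finset.sum_congr rfl fun l _ => ?_
  rw [← C_pow, coeff_C_mul_X_pow]
  by_cases hd : n = d l
  · simp [hd, coeff_X_pow, eq_comm]
  · simp [hd, Ne.symm hd]

theorem A1count_eq_card {n N : ℕ} (hN : n ≤ N) (m : ℕ) :
    A1count n m = ((aVee N).filter fun l => l.1.sum id = n ∧ aVeeWeight l = m).card := by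
  rw [A1count, ← Set.ncard_coe_finset]
  congr 1
  ext l
  rw [Set.mem_ofPred_eq, Finset.mem_coe, Finset.mem_filter, mem_aVee, aVeeWeight]
  have h (hl : l.1.sum id = n) : ∀ p ∈ l.1, p ≤ N := fun p hp =>
    ((Finset.single_le_sum (f := id) (fun _ _ => Nat.zero_le _) hp).trans_eq hl).trans hN
  tauto

theorem B1count_eq_card {n N : ℕ} (hN : n < N) (m : ℕ) :
    B1count n m = (((Finset.range N).filter fun p => ¬ 4 ∣ p).powerset.filter
      fun t => t.sum id = n ∧ t.card = m).card := by
  rw [B1count, ← Set.ncard_coe_finset]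
  congr 1
  ext t
  simp only [Set.mem_ofPred_eq, Finset.mem_coe, Finset.mem_filter, Finset.mem_powerset]
  have h (ht : t.sum id = n) : ∀ p ∈ t, p < N := fun p hp =>
    ((Finset.single_le_sum (f := id) (fun _ _ => Nat.zero_le _) hp).trans_eq ht).trans_lt hN
  constructor
  · rintro ⟨h1, h2, h3⟩
    exact ⟨fun p hp => by simpa using ⟨h h3 p hp, (h1 p hp).2⟩, h3, h2⟩
  · rintro ⟨h1, h2, h3⟩
    refine ⟨fun p hp => ?_, h3, h2⟩
    have h4 := (Finset.mem_filter.1 (h1 hp)).2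
    exact ⟨Nat.pos_of_ne_zero fun h0 => h4 (h0 ▸ dvd_zero 4), h4⟩

/-- **Theorem A1** (Andrews): `A₁(n,m) = B₁(n,m)`. -/
theorem A1_eq_B1 (n m : ℕ) : A1count n m = B1count n m := by
  have h := BoundedPartRec.pow_dvd_sub_prod (R := Polynomial (Polynomial ℤ)) Polynomial.X_ne_zero
    (fun x => boundedPartRec_aVeeGen Polynomial.X x) (n + 1) 0 (Polynomial.C Polynomial.X) (by simp)
  have hn := Polynomial.X_pow_dvd_iff.1 h n (by lia)
  rw [Polynomial.coeff_sub, sub_eq_zero, prod_range_eq_sum_powerset, aVeeGen] at hn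
  have hm := congrArg (fun p => p.coeff m) hn
  simp only [coeff_coeff_sum, Nat.cast_inj] at hm
  rw [A1count_eq_card (by lia : n ≤ 4 * (n + 1) + 8),
    B1count_eq_card (by lia : n < 4 * (n + 1 + 2)), hm]
end
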